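/- Let T be a simple graph on vertex set ℕ, let φ : G_T → ℕ be a coding bijection as described, and let ⋆ be the induced group operation on ℕ. Let s be an injective finite sequence of natural numbers with domain dom(s) = {0, …, length(s)−1}. Then there exists a group automorphism h of (ℕ, ⋆) with h(n) = s(n) for every n ∈ dom(s) if and only if the following two conditions hold: (1) for all n, m ∈ dom(s), if n ⋆ m ∈ dom(s) then s(n ⋆ m) = s(n) ⋆ s(m); (2) there exists a map r : {i ∈ ℕ : 3i+1 ∈ dom(s)} → ℕ such that (a) some graph automorphism ρ of T satisfies ρ(i) = r(i) for all i in the domain of r, and (b) there exist k, k' ∈ ℕ with k ⋆ k' = 0 and l ∈ {0, 1} such that s(3i+1) = k ⋆ (3 r(i) + 1 + l) ⋆ k' for every i ∈ ℕ with 3i+1 ∈ dom(s). -/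

import Mathlib

/-- The relators of Williams' group `G_T` associated to a graph with adjacency relation
`Adj`: the relators are `v_i^7`, `(v_i v_j)^11` for adjacent `i, j`, and `(v_i v_j)^13`
for distinct non-adjacent `i, j`. -/
def grRels (Adj : ℕ → ℕ → Prop) : Set (FreeGroup ℕ) :=
  {r | (∃ i, r = FreeGroup.of i ^ 7) ∨
    (∃ i j, Adj i j ∧ r = (FreeGroup.of i * FreeGroup.of j) ^ 11) ∨
    (∃ i j, i ≠ j ∧ ¬ Adj i j ∧ r = (FreeGroup.of i * FreeGroup.of j) ^ 13)}

/-- Williams' group `G_T`, presented by the generators `v_i` and the relators above. -/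
abbrev GT (Adj : ℕ → ℕ → Prop) : Type := PresentedGroup (grRels Adj)

/-- The generator `v_i` of `G_T`. -/
def gen (Adj : ℕ → ℕ → Prop) (i : ℕ) : GT Adj := PresentedGroup.of i

/-- A coding bijection for `G_T`: a bijection `φ : G_T → ℕ` together with an assignment to
each element of `G_T` of a reduced word (i.e. a free group element) representing it, such
that `φ(1) = 0`, `φ(v_i) = 3i+1`, `φ(v_i⁻¹) = 3i+2`, the obvious words are assigned to
`1`, `v_i`, `v_i⁻¹`, and every proper subword of the word assigned to `φ⁻¹(n)` represents
an element with `φ`-value strictly less than `n`. -/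
structure CodingBijection (Adj : ℕ → ℕ → Prop) where
  toEquiv : GT Adj ≃ ℕ
  word : GT Adj → FreeGroup ℕ
  word_mk : ∀ g, (QuotientGroup.mk (word g) : GT Adj) = g
  word_one : word 1 = 1
  word_gen : ∀ i, word (gen Adj i) = FreeGroup.of i
  word_gen_inv : ∀ i, word (gen Adj i)⁻¹ = (FreeGroup.of i)⁻¹
  map_one : toEquiv 1 = 0
  map_gen : ∀ i, toEquiv (gen Adj i) = 3 * i + 1
  map_gen_inv : ∀ i, toEquiv (gen Adj i)⁻¹ = 3 * i + 2
  subword_lt : ∀ (n : ℕ) (u : FreeGroup ℕ),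
    u.toWord <:+: (word (toEquiv.symm n)).toWord →
    u.toWord ≠ (word (toEquiv.symm n)).toWord →
    toEquiv (QuotientGroup.mk u : GT Adj) < n

/-- The group operation on `ℕ` induced by a coding bijection:
`n ⋆ m = φ(φ⁻¹(n) · φ⁻¹(m))`. -/
def CodingBijection.star {Adj : ℕ → ℕ → Prop} (c : CodingBijection Adj) (n m : ℕ) : ℕ :=
  c.toEquiv (c.toEquiv.symm n * c.toEquiv.symm m)


namespace WG

/-- Letters: a generator index with a sign (`true` for positive). -/
abbrev Ltr := ℕ × Bool

/-- The alternating word `a b a b ...` with `k` letters, all of sign `s`. -/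
def salt (s : Bool) : ℕ → ℕ → ℕ → List Ltr
  | _, _, 0 => []
  | a, b, k + 1 => (a, s) :: salt s b a k

/-- The letter in position `k` of the sequence `a b a b ...`. -/
def top (a b k : ℕ) : ℕ := if k % 2 = 0 then a else b

/-- The reversed alternating positive word. -/
def rsalt (a b : ℕ) : ℕ → List Ltr
  | 0 => []
  | k + 1 => (top a b k, true) :: rsalt a b k

/-- The length function of the relators. -/
structure NN (n : ℕ → ℕ → ℕ) : Prop where
  symm : ∀ a b, n a b = n b a
  self : ∀ a, n a a = 7
  ne : ∀ a b, a ≠ b → n a b = 22 ∨ n a b = 26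

theorem NN.ge {n} (h : NN n) (a b : ℕ) : 7 ≤ n a b := by
  by_cases hab : a = b
  · subst hab; rw [h.self]
  · rcases h.ne a b hab with h | h <;> omega

theorem top_succ (a b k : ℕ) : top a b (k + 1) = top b a k := by
  unfold top; split_ifs <;> first | rfl | omega

theorem top_self (a k : ℕ) : top a a k = a := by unfold top; split_ifs <;> rfl

theorem top_or (a b k : ℕ) : top a b k = a ∨ top a b k = b := by
  unfold top; split_ifs <;> simp

theorem NN.top2 {n} (h : NN n) (a b : ℕ) : top a b (n a b - 2) = a := by
  by_cases hab : a = b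
  · subst hab; rw [top_self]
  · unfold top; rcases h.ne a b hab with h | h <;> rw [h] <;> rfl

theorem NN.top3 {n} (h : NN n) (a b : ℕ) : top a b (n a b - 3) = b := by
  by_cases hab : a = b
  · subst hab; rw [top_self]
  · unfold top; rcases h.ne a b hab with h | h <;> rw [h] <;> rfl

theorem NN.top4 {n} (h : NN n) (a b : ℕ) : top a b (n a b - 4) = a := by
  by_cases hab : a = b
  · subst hab; rw [top_self]
  · unfold top; rcases h.ne a b hab with h | h <;> rw [h] <;> rfl

theorem salt_length (s : Bool) (a b k : ℕ) : (salt s a b k).length = k := by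
  induction k generalizing a b with
  | zero => rfl
  | succ k ih => simp [salt, ih]

theorem salt_snoc (s : Bool) (a b k : ℕ) :
    salt s a b (k + 1) = salt s a b k ++ [(top a b k, s)] := by
  induction k generalizing a b with
  | zero => rfl
  | succ k ih =>
    rw [salt, ih, top_succ]; rfl

theorem rsalt_salt (a b k j : ℕ) :
    rsalt a b k ++ salt true b a j = salt true (top b a k) (top a b k) (k + j) := by
  induction k with
  | zero => simp [rsalt, top]
  | succ k ih =>
    rw [rsalt, List.cons_append, ih, top_succ, top_succ]
    rw [show k + 1 + j = (k + j) + 1 by omega, salt]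

theorem rsalt_eq (a b k : ℕ) : rsalt a b k = salt true (top b a k) (top a b k) k := by
  simpa [salt] using rsalt_salt a b k 0

/-- Matching heads of alternating words. -/
theorem salt_inj {f : ℕ → ℕ} {x y y' : ℕ} {A B : List Ltr} (hf : 1 ≤ f y) (hf' : 1 ≤ f y')
    (h : salt true y x (f y) ++ A = salt true y' x (f y') ++ B) : y = y' ∧ A = B := by
  have h1 : y = y' := by
    obtain ⟨u, hu⟩ := Nat.exists_eq_add_of_le' hf
    obtain ⟨v, hv⟩ := Nat.exists_eq_add_of_le' hf'
    rw [hu, hv] at h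
    simp [salt] at h
    exact h.1
  subst h1
  exact ⟨rfl, List.append_cancel_left h⟩

variable (n : ℕ → ℕ → ℕ)

/-- Condition for a letter to be put on top of a normal stack. -/
def ok : Ltr → List Ltr → Prop
  | (x, true), S => (∀ S', S ≠ (x, false) :: S') ∧
      (∀ y S', S ≠ salt true y x (n x y - 2) ++ S') ∧
      (∀ y c S', S ≠ salt true y x (n x y - 3) ++ (c, false) :: S')
  | (x, false), S => ∀ y s S', S = (y, s) :: S' → s = true ∧ y ≠ x

/-- Normal stacks. -/
def Normal : List Ltr → Prop
  | [] => True
  | l :: S => ok n l S ∧ Normal S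

theorem Normal.suffix {n} {A B : List Ltr} (h : Normal n (A ++ B)) : Normal n B := by
  induction A with
  | nil => exact h
  | cons a A ih => exact ih h.2

open Classical in
/-- Push a positive letter on a stack. -/
noncomputable def push (x : ℕ) (S : List Ltr) : List Ltr :=
  if h1 : ∃ S', S = (x, false) :: S' then h1.choose
  else if h2 : ∃ p : ℕ × List Ltr, S = salt true p.1 x (n x p.1 - 2) ++ p.2 then
    (h2.choose.1, false) :: h2.choose.2
  else if h3 : ∃ p : ℕ × ℕ × List Ltr,
      S = salt true p.1 x (n x p.1 - 3) ++ (p.2.1, false) :: p.2.2 then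
    (h3.choose.1, false) :: (salt true h3.choose.2.1 x (n x h3.choose.2.1 - 3) ++
      push x h3.choose.2.2)
  else (x, true) :: S
termination_by S.length
decreasing_by
  have := congrArg List.length h3.choose_spec
  simp only [List.length_append, List.length_cons] at this
  omega

theorem salt_ne_neg {k : ℕ} (hk : 1 ≤ k) {a b x : ℕ} {S S' : List Ltr} :
    (x, false) :: S ≠ salt true a b k ++ S' := by
  obtain ⟨u, rfl⟩ := Nat.exists_eq_add_of_le' hk
  simp [salt]

variable {n}

theorem push_cancel (x : ℕ) (S : List Ltr) : push n x ((x, false) :: S) = S := by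
  have h1 : ∃ S', (x, false) :: S = (x, false) :: S' := ⟨S, rfl⟩
  rw [push, dif_pos h1]
  have := h1.choose_spec
  simpa using this.symm

theorem push_r2 (hn : NN n) (x y : ℕ) (S : List Ltr) :
    push n x (salt true y x (n x y - 2) ++ S) = (y, false) :: S := by
  have hg := hn.ge x
  have h1 : ¬ ∃ S', salt true y x (n x y - 2) ++ S = (x, false) :: S' := by
    rintro ⟨S', h⟩
    exact salt_ne_neg (by have := hg y; omega) h.symm
  have h2 : ∃ p : ℕ × List Ltr, salt true y x (n x y - 2) ++ S
      = salt true p.1 x (n x p.1 - 2) ++ p.2 := ⟨(y, S), rfl⟩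
  rw [push, dif_neg h1, dif_pos h2]
  have := salt_inj (f := fun y => n x y - 2) (by have := hg y; omega)
    (by have := hg h2.choose.1; omega) h2.choose_spec
  rw [← this.1, ← this.2]

theorem r2_r4 (hn : NN n) {x y y' c : ℕ} {A B : List Ltr} :
    salt true y x (n x y - 2) ++ A ≠ salt true y' x (n x y' - 3) ++ (c, false) :: B := by
  intro h
  have hg := hn.ge x
  rw [show n x y - 2 = (n x y - 3) + 1 by have := hg y; omega, salt_snoc, List.append_assoc] at h
  have := (salt_inj (f := fun y => n x y - 3) (by have := hg y; omega)
    (by have := hg y'; omega) h).2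
  simp at this

theorem push_r4 (hn : NN n) (x y c : ℕ) (S : List Ltr) :
    push n x (salt true y x (n x y - 3) ++ (c, false) :: S)
      = (y, false) :: (salt true c x (n x c - 3) ++ push n x S) := by
  have hg := hn.ge x
  have h1 : ¬ ∃ S', salt true y x (n x y - 3) ++ (c, false) :: S = (x, false) :: S' := by
    rintro ⟨S', h⟩
    exact salt_ne_neg (by have := hg y; omega) h.symm
  have h2 : ¬ ∃ p : ℕ × List Ltr, salt true y x (n x y - 3) ++ (c, false) :: S
      = salt true p.1 x (n x p.1 - 2) ++ p.2 := by
    rintro ⟨p, h⟩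
    exact r2_r4 hn h.symm
  have h3 : ∃ p : ℕ × ℕ × List Ltr, salt true y x (n x y - 3) ++ (c, false) :: S
      = salt true p.1 x (n x p.1 - 3) ++ (p.2.1, false) :: p.2.2 := ⟨(y, c, S), rfl⟩
  rw [push, dif_neg h1, dif_neg h2, dif_pos h3]
  have := salt_inj (f := fun y => n x y - 3) (by have := hg y; omega)
    (by have := hg h3.choose.1; omega) h3.choose_spec
  obtain ⟨e1, e2⟩ := this
  simp only [List.cons.injEq, Prod.mk.injEq, and_true] at e2
  rw [← e1, ← e2.1, ← e2.2]

theorem push_cons {x : ℕ} {S : List Ltr} (h : ok n (x, true) S) :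
    push n x S = (x, true) :: S := by
  rw [push, dif_neg, dif_neg, dif_neg]
  · rintro ⟨p, hp⟩; exact h.2.2 _ _ _ hp
  · rintro ⟨p, hp⟩; exact h.2.1 _ _ hp
  · rintro ⟨p, hp⟩; exact h.1 _ hp

theorem ok_cases (n : ℕ → ℕ → ℕ) (x : ℕ) (S : List Ltr) : (∃ S', S = (x, false) :: S') ∨
    (∃ y S', S = salt true y x (n x y - 2) ++ S') ∨
    (∃ y c S', S = salt true y x (n x y - 3) ++ (c, false) :: S') ∨ ok n (x, true) S := by
  by_contra h
  push Not at h
  exact h.2.2.2 ⟨h.1, h.2.1, h.2.2.1⟩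

/-- Key extension step. -/
theorem ok_step (hn : NN n) {a b k : ℕ} {S : List Ltr} (hk : 1 ≤ k) (hk' : k + 3 ≤ n a b)
    (hb : ∀ S', S ≠ (b, true) :: S') (hneg : k + 3 = n a b → ∀ c S', S ≠ (c, false) :: S') :
    ok n (top a b k, true) (rsalt a b k ++ S) := by
  have hhead : ∃ R, rsalt a b k = (top b a k, true) :: R := by
    obtain ⟨u, rfl⟩ := Nat.exists_eq_add_of_le' hk
    exact ⟨_, by rw [rsalt, top_succ]⟩
  obtain ⟨R, hR⟩ := hhead
  have hnn : n (top a b k) (top b a k) = n a b := by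
    unfold top; split_ifs
    · rfl
    · exact hn.symm _ _
  refine ⟨?_, ?_, ?_⟩
  · intro S' h; rw [hR] at h; simp at h
  · intro y S' h
    have hy : y = top b a k := by
      have h7 := hn.ge (top a b k) y
      rw [hR, show n (top a b k) y - 2 = (n (top a b k) y - 3) + 1 by omega, salt] at h
      simp at h; exact h.1.symm
    subst hy
    rw [hnn, show n a b - 2 = k + ((n a b - 3 - k) + 1) by omega, ← rsalt_salt,
      List.append_assoc] at h
    have := List.append_cancel_left h
    rw [salt] at this
    exact hb _ this
  · intro y c S' h
    have hy : y = top b a k := by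
      have h7 := hn.ge (top a b k) y
      rw [hR, show n (top a b k) y - 3 = (n (top a b k) y - 4) + 1 by omega, salt] at h
      simp at h; exact h.1.symm
    subst hy
    by_cases hkk : k + 3 = n a b
    · rw [hnn, show n a b - 3 = k + 0 by omega, ← rsalt_salt, List.append_assoc] at h
      have := List.append_cancel_left h
      exact hneg hkk _ _ this
    · rw [hnn, show n a b - 3 = k + ((n a b - 4 - k) + 1) by omega, ← rsalt_salt,
        List.append_assoc] at h
      have := List.append_cancel_left h
      rw [salt] at this
      exact hb _ this

theorem normal_a (hn : NN n) {a b k : ℕ} {S : List Ltr} (hS : Normal n ((a, true) :: S))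
    (hneg : ∀ c S', S ≠ (c, false) :: S') (hb : ∀ S', S ≠ (b, true) :: S')
    (hk : k + 2 ≤ n a b) : Normal n (rsalt a b k ++ S) := by
  induction k with
  | zero => exact hS.2
  | succ k ih =>
    refine ⟨?_, ih (by omega)⟩
    rcases Nat.eq_zero_or_pos k with rfl | h
    · exact hS.1
    · exact ok_step hn h (by omega) hb (fun _ => hneg)

theorem normal_b (hn : NN n) {a b c k : ℕ} {S : List Ltr} (hS : Normal n ((c, false) :: S))
    (hc : c ≠ a) (hk : k + 3 ≤ n a b) : Normal n (rsalt a b k ++ (c, false) :: S) := by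
  induction k with
  | zero => exact hS
  | succ k ih =>
    refine ⟨?_, ih (by omega)⟩
    rcases Nat.eq_zero_or_pos k with rfl | h
    · refine ⟨?_, ?_, ?_⟩
      · intro S' h; simp [rsalt, top] at h; exact hc h.1
      · intro y S' h
        exact salt_ne_neg (by have := hn.ge (top a b 0) y; omega) h
      · intro y d S' h
        exact salt_ne_neg (by have := hn.ge (top a b 0) y; omega) h
    · exact ok_step hn h (by omega) (by simp) (fun h => by omega)

/-- Pushing on a stack whose top is not negative. -/
theorem push_form (hn : NN n) (x : ℕ) {S : List Ltr} 
    (hneg : ∀ c S', S ≠ (c, false) :: S') :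
    (push n x S = (x, true) :: S ∧ ok n (x, true) S) ∨
    (∃ z T R, push n x S = (z, false) :: T ∧ S = (z, true) :: R) := by
  rcases ok_cases n x S with ⟨S', rfl⟩ | ⟨y, S', rfl⟩ | ⟨y, c, S', rfl⟩ | h
  · exact absurd rfl (hneg _ _)
  · right
    refine ⟨y, _, salt true x y (n x y - 3) ++ S', push_r2 hn _ _ _, ?_⟩
    rw [show n x y - 2 = (n x y - 3) + 1 by have := hn.ge x y; omega, salt, List.cons_append]
  · right
    refine ⟨y, _, salt true x y (n x y - 4) ++ (c, false) :: S', push_r4 hn _ _ _ _, ?_⟩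
    rw [show n x y - 3 = (n x y - 4) + 1 by have := hn.ge x y; omega, salt, List.cons_append]
  · left; exact ⟨push_cons h, h⟩

theorem neg_head {c : ℕ} {S : List Ltr} (h : Normal n ((c, false) :: S)) :
    (∀ d S', S ≠ (d, false) :: S') ∧ (∀ S', S ≠ (c, true) :: S') := by
  constructor
  · rintro d S' rfl
    have := h.1 d false S' rfl
    simp at this
  · rintro S' rfl
    have := h.1 c true S' rfl
    simp at this

theorem salt23 (hn : NN n) (c x : ℕ) (S : List Ltr) :
    salt true c x (n x c - 3) ++ (x, true) :: S = rsalt x c (n x c - 2) ++ S := by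
  rw [rsalt_eq, hn.top2, hn.symm x c, hn.top2,
    show n c x - 2 = (n c x - 3) + 1 by have := hn.ge c x; omega, salt_snoc, hn.top3]
  simp

theorem salt3 (hn : NN n) (c x : ℕ) :
    salt true c x (n x c - 3) = rsalt c x (n x c - 3) := by
  rw [rsalt_eq, hn.top3, hn.symm x c, hn.top3]

theorem normal_g (hn : NN n) (x : ℕ) {c : ℕ} {S : List Ltr} (hS : Normal n ((c, false) :: S))
    (hT : Normal n (push n x S)) : Normal n (salt true c x (n x c - 3) ++ push n x S) := by
  have hh := neg_head hS
  have hg := hn.ge x c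
  rcases push_form hn x hh.1 with ⟨h, h'⟩ | ⟨z, T, R, h, hz⟩
  · rw [h, salt23 hn]
    exact normal_a hn ⟨h', hS.2⟩ hh.1 hh.2 (by omega)
  · rw [h, salt3 hn]
    rw [h] at hT
    refine normal_b hn hT ?_ (by rw [hn.symm c x]; omega)
    rintro rfl
    exact hh.2 _ hz

theorem normal_push (hn : NN n) (x : ℕ) (S : List Ltr) (hS : Normal n S) :
    Normal n (push n x S) := by
  induction hl : S.length using Nat.strong_induction_on generalizing S with
  | _ l ih =>
  rcases ok_cases n x S with ⟨S', rfl⟩ | ⟨y, S', rfl⟩ | ⟨y, c, S', rfl⟩ | h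
  · rw [push_cancel]; exact hS.2
  · rw [push_r2 hn]
    refine ⟨?_, hS.suffix⟩
    rintro z s R rfl
    have hg := hn.ge x y
    cases s with
    | false =>
      exfalso
      rw [show n x y - 2 = (n x y - 3) + 1 by omega, salt, List.cons_append] at hS
      have h1 := hS.1.2.2 x z R
      rw [hn.symm y x] at h1
      exact h1 rfl
    | true =>
      refine ⟨rfl, ?_⟩
      rintro rfl
      rw [show n x z - 2 = (n x z - 3) + 1 by omega, salt, List.cons_append] at hS
      have h1 := hS.1.2.1 x R
      rw [hn.symm z x, show n x z - 2 = (n x z - 3) + 1 by omega, salt_snoc] at h1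
      have := hn.top3 x z
      rw [this] at h1
      apply h1
      simp
  · rw [push_r4 hn]
    have hc := hS.suffix
    have hg := hn.ge x y
    have hS' : Normal n (push n x S') := by
      refine ih S'.length ?_ S' hc.2 rfl
      subst hl; simp; omega
    have hG := normal_g hn x hc hS'
    refine ⟨?_, hG⟩
    intro z s R hz
    rw [show n x c - 3 = (n x c - 4) + 1 by have := hn.ge x c; omega, salt] at hz
    simp at hz
    obtain ⟨⟨rfl, rfl⟩, -⟩ := hz
    refine ⟨rfl, ?_⟩
    rintro rfl
    rw [show n x c - 3 = (n x c - 4) + 1 by omega, salt_snoc, hn.symm x c, hn.top4,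
      List.append_assoc] at hS
    have := hS.suffix.1.1 S'
    simp at this
  · rw [push_cons h]; exact ⟨h, hS⟩

/-- Push `a`, `b`, `a`, ... (`k` letters). -/
noncomputable def runs (n : ℕ → ℕ → ℕ) : ℕ → ℕ → ℕ → List Ltr → List Ltr
  | _, _, 0, S => S
  | a, b, k + 1, S => runs n b a k (push n a S)

theorem runs_succ (a b k : ℕ) (S : List Ltr) :
    runs n a b (k + 1) S = push n (top a b k) (runs n a b k S) := by
  induction k generalizing a b S with
  | zero => rfl
  | succ k ih => rw [runs, ih, top_succ]; rfl

theorem runs_normal {a b k : ℕ} {S : List Ltr} (h : Normal n (rsalt a b k ++ S)) :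
    runs n a b k S = rsalt a b k ++ S := by
  induction k with
  | zero => rfl
  | succ k ih =>
    have h1 : ok n (top a b k, true) (rsalt a b k ++ S) := h.1
    rw [runs_succ, ih h.2, push_cons h1]; rfl

theorem runs_e (hn : NN n) {a b z : ℕ} {T : List Ltr} (hT : Normal n ((z, false) :: T))
    (hz : z ≠ a) : runs n a b (n a b - 2) ((z, false) :: T)
      = (a, false) :: (salt true z b (n b z - 3) ++ push n b T) := by
  have hg := hn.ge a b
  rw [show n a b - 2 = (n a b - 3) + 1 by omega, runs_succ,
    runs_normal (normal_b hn hT hz (by omega)), hn.top3, ← hn.symm b a, ← salt3 hn, push_r4 hn]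

theorem runs_g (hn : NN n) (x : ℕ) {c : ℕ} {S : List Ltr} (hS : Normal n ((c, false) :: S)) :
    runs n x c (n x c - 1) S = push n x (salt true c x (n x c - 3) ++ push n x S) := by
  have hG := normal_g hn x hS (normal_push hn x S hS.2)
  have hg := hn.ge x c
  rw [show n x c - 1 = (n x c - 2) + 1 by omega, runs_succ, hn.top2,
    show n x c - 2 = (n x c - 3) + 1 by omega, runs, salt3 hn]
  rw [salt3 hn] at hG
  rw [runs_normal hG]

theorem runs_b (hn : NN n) (a b : ℕ) (S : List Ltr) (hS : Normal n ((a, false) :: S)) :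
    runs n b a (n b a - 1) S = (a, false) :: S := by
  induction hl : S.length using Nat.strong_induction_on generalizing S a b with
  | _ l ih =>
  have hh := neg_head hS
  have hg := hn.ge b a
  rcases ok_cases n b S with ⟨S', rfl⟩ | ⟨z, S', rfl⟩ | ⟨z, c, S', rfl⟩ | h
  · exact absurd rfl (hh.1 _ _)
  · have hT := normal_push hn b _ hS.2
    rw [show n b a - 1 = (n a b - 2) + 1 by have := hn.symm a b; omega, runs]
    rw [push_r2 hn] at hT ⊢
    have hg' := hn.ge b z
    rw [runs_e hn hT]
    · have h2 := hS.2
      rw [show n b z - 2 = (n b z - 3) + 1 by omega, salt_snoc, hn.symm b z, hn.top3,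
        List.append_assoc] at h2
      have h3 : ok n (b, true) S' := h2.suffix.1
      rw [push_cons h3, show n b z - 2 = (n b z - 3) + 1 by omega, salt_snoc, hn.symm b z, hn.top3,
        List.append_assoc]
      rfl
    · rintro rfl
      apply hh.2 (salt true b z (n b z - 3) ++ S')
      rw [show n b z - 2 = (n b z - 3) + 1 by omega, salt, List.cons_append]
  · have hT := normal_push hn b _ hS.2
    rw [show n b a - 1 = (n a b - 2) + 1 by have := hn.symm a b; omega, runs]
    rw [push_r4 hn] at hT ⊢
    have hg' := hn.ge b z
    have hc := hS.2.suffix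
    rw [runs_e hn hT]
    · rw [← runs_g hn b hc, ih S'.length (by subst hl; simp; omega) c b S' hc rfl]
    · rintro rfl
      apply hh.2 (salt true b z (n b z - 4) ++ (c, false) :: S')
      rw [show n b z - 3 = (n b z - 4) + 1 by omega, salt, List.cons_append]
  · rw [show n b a - 1 = (n b a - 2) + 1 by omega, runs_succ,
      runs_normal (normal_a hn ⟨h, hS.2⟩ hh.1 hh.2 (by omega)), hn.top2, rsalt_eq, hn.top2,
      hn.symm b a, hn.top2, hn.symm a b, push_r2 hn]

theorem push_g (hn : NN n) (x : ℕ) {c : ℕ} {S : List Ltr} (hS : Normal n ((c, false) :: S)) :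
    push n x (salt true c x (n x c - 3) ++ push n x S) = (c, false) :: S := by
  rw [← runs_g hn x hS, runs_b hn _ _ _ hS]

theorem NN.top1 {n} (h : NN n) (a b : ℕ) : top a b (n a b - 1) = b := by
  by_cases hab : a = b
  · subst hab; rw [top_self]
  · unfold top; rcases h.ne a b hab with h | h <;> rw [h] <;> rfl

theorem NN.top0 {n} (h : NN n) (a b : ℕ) : top a b (n a b) = a := by
  by_cases hab : a = b
  · subst hab; rw [top_self]
  · unfold top; rcases h.ne a b hab with h | h <;> rw [h] <;> rfl

/-- The relators act trivially. -/
theorem runs_rel (hn : NN n) (a b : ℕ) (S : List Ltr) (hS : Normal n S) :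
    runs n a b (n a b) S = S := by
  induction hl : S.length using Nat.strong_induction_on generalizing S a b with
  | _ l ih =>
  have hg := hn.ge a b
  by_cases hb : Normal n ((b, false) :: S)
  · rw [show n a b = (n a b - 1) + 1 by omega, runs_succ, runs_b hn _ _ _ hb, hn.top1, push_cancel]
  · rcases S with _ | ⟨⟨c, s⟩, S⟩
    · exact absurd ⟨by intro y s S' h; simp at h, trivial⟩ hb
    · cases s with
      | true =>
        by_cases hcb : c = b
        · subst hcb
          have h1 : runs n a c (n a c) (push n c S) = runs n c a (n a c + 1) S := rfl
          rw [← push_cons hS.1, h1, runs_succ, hn.symm a c, hn.top0,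
            ih S.length (by subst hl; simp) c a S hS.2 rfl]
        · exfalso
          apply hb
          refine ⟨?_, hS⟩
          intro y s S' h
          simp at h
          obtain ⟨⟨rfl, rfl⟩, -⟩ := h
          exact ⟨rfl, hcb⟩
      | false =>
        by_cases hca : c = a
        · subst hca
          rw [show n c b = (n b c - 1) + 1 by have := hn.symm b c; omega, runs, push_cancel,
            runs_b hn _ _ _ hS]
        · rw [show n a b = ((n a b - 2) + 1) + 1 by omega, runs_succ, runs_succ,
            runs_e hn hS hca, hn.top2, push_cancel,
            show n a b - 2 + 1 = n a b - 1 by omega, hn.top1, push_g hn _ hS]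

end WG

namespace WG

/-- Reduced words without long pieces of relators. -/
structure Nice (n : ℕ → ℕ → ℕ) (w : List Ltr) : Prop where
  red : ∀ A B x s, w ≠ A ++ (x, s) :: (x, !s) :: B
  win : ∀ s a b A B, w ≠ A ++ (salt s a b (n a b - 3) ++ B)

variable {n : ℕ → ℕ → ℕ}

theorem Nice.suffix {A w : List Ltr} (h : Nice n (A ++ w)) : Nice n w :=
  ⟨fun A' B x s e => h.red (A ++ A') B x s (by rw [e]; simp),
   fun s a b A' B e => h.win s a b (A ++ A') B (by rw [e]; simp)⟩

theorem salt_add (s : Bool) (a b j k : ℕ) :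
    salt s a b (j + k) = salt s a b j ++ salt s (top a b j) (top b a j) k := by
  induction j generalizing a b with
  | zero => simp [salt, top]
  | succ j ih =>
    rw [show j + 1 + k = (j + k) + 1 by omega, salt, ih, salt, top_succ, top_succ]; rfl

theorem Nice.lt {w B A : List Ltr} (h : Nice n w) {s a b k} (e : w = A ++ (salt s a b k ++ B)) :
    k < n a b - 3 := by
  by_contra hk
  push Not at hk
  obtain ⟨m, rfl⟩ := Nat.exists_eq_add_of_le hk
  rw [salt_add, List.append_assoc] at e
  exact h.win _ _ _ _ _ e

/-- Run states. -/
def IsRun (n : ℕ → ℕ → ℕ) (w S : List Ltr) : Prop :=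
  ∃ x c k w' S', 2 ≤ k ∧ w = salt false x c k ++ w' ∧ S = salt true c x (n x c - k) ++ S'

/-- The invariant relating a nice word with its stack. -/
inductive Inv (n : ℕ → ℕ → ℕ) : List Ltr → List Ltr → Prop
  | nil : Inv n [] []
  | pos (x w S) : Inv n w S → Inv n ((x, true) :: w) ((x, true) :: S)
  | neg (x w S) : Inv n w S → ok n (x, false) S → Inv n ((x, false) :: w) ((x, false) :: S)
  | run (w S) : IsRun n w S → Inv n w S

theorem invA (N : ℕ) : ∀ (y x : ℕ) (w S R : List Ltr), Inv n w S → S = salt true y x N ++ R →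
    (∃ B, w = salt true y x N ++ B) ∨ ∃ j w0 S0, j < N ∧ w = salt true y x j ++ w0 ∧
      S = salt true y x j ++ S0 ∧ IsRun n w0 S0 := by
  induction N with
  | zero => intro y x w S R _ _; left; exact ⟨w, rfl⟩
  | succ N ih =>
    intro y x w S R h e
    rw [salt] at e
    cases h with
    | nil => simp at e
    | pos z w S h =>
      simp at e
      obtain ⟨rfl, e⟩ := e
      rcases ih x z w S R h e with ⟨B, rfl⟩ | ⟨j, w0, S0, hj, rfl, rfl, hr⟩
      · left; exact ⟨B, rfl⟩
      · right; exact ⟨j + 1, w0, S0, by omega, rfl, rfl, hr⟩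
    | neg z w S h _ => simp at e
    | run _ _ h => right; exact ⟨0, w, S, by omega, rfl, rfl, h⟩

theorem salt_two (s : Bool) (a b : ℕ) {k : ℕ} (hk : 2 ≤ k) :
    salt s a b k = (a, s) :: (b, s) :: salt s a b (k - 2) := by
  obtain ⟨u, rfl⟩ := Nat.exists_eq_add_of_le' hk
  rfl

theorem invB (hn : NN n) (x : ℕ) {w S : List Ltr} (hw : Nice n w) (h : Inv n w S) :
    ok n (x, true) S ∨ ∃ w', w = (x, false) :: w' := by
  have key : ∀ y N R, 1 ≤ N → S = salt true y x N ++ R →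
      (N = n x y - 2 ∨ (N = n x y - 3 ∧ ∃ c R', R = (c, false) :: R')) →
      ∃ w', w = (x, false) :: w' := by
    intro y N R hN1 e hN
    have hg := hn.ge x y
    have hsy := hn.symm x y
    rcases invA N y x w S R h e with ⟨B, hB⟩ | ⟨j, w0, S0, hj, e1, e2, hr⟩
    · have := hw.lt (A := []) hB
      omega
    · obtain ⟨p, q, k, w', S', hk, hw0, hS0⟩ := hr
      have hk2 : k < n p q - 3 := by
        subst e1
        exact hw.suffix.lt (A := []) hw0
      rw [salt_two _ _ _ hk] at hw0
      rw [salt_two _ _ _ (by omega)] at hS0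
      rw [e2, show N = j + (N - j) by omega, salt_add, List.append_assoc] at e
      have e3 := List.append_cancel_left e
      rw [hS0] at e3
      by_cases hNj : 2 ≤ N - j
      · rw [salt_two _ _ _ hNj] at e3
        simp at e3
        obtain ⟨hq, hp, -⟩ := e3
        rcases Nat.eq_zero_or_pos j with rfl | hj0
        · simp [top] at hp
          subst hp
          exact ⟨_, by rw [e1, hw0]; rfl⟩
        · exfalso
          obtain ⟨i, rfl⟩ := Nat.exists_eq_add_of_le' hj0
          rw [salt_snoc, ← top_succ, ← hp, List.append_assoc, hw0] at e1
          exact hw.red _ _ p true e1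
      · have hj1 : N - j = 1 := by omega
        rcases hN with hN | ⟨hN, c, R', rfl⟩
        · have := hw.lt (A := []) e1
          omega
        · rw [hj1] at e3
          simp [salt] at e3
  rcases ok_cases n x S with ⟨S', rfl⟩ | ⟨y, S', e⟩ | ⟨y, c, S', e⟩ | h'
  · right
    cases h with
    | neg z w S h _ => exact ⟨w, rfl⟩
    | run _ _ h =>
      exfalso
      obtain ⟨p, q, k, w', S', hk, hw0, hS0⟩ := h
      have := hw.lt (A := []) hw0
      rw [salt_two _ _ _ (by omega)] at hS0
      simp at hS0
  · right; exact key y _ _ (by have := hn.ge x y; omega) e (Or.inl rfl)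
  · right; exact key y _ _ (by have := hn.ge x y; omega) e (Or.inr ⟨rfl, c, S', rfl⟩)
  · left; exact h'

/-- Action of words on the empty stack. -/
def Reach (n : ℕ → ℕ → ℕ) : List Ltr → List Ltr → Prop
  | [], S => S = []
  | (x, true) :: w, S => ∃ S0, Reach n w S0 ∧ Normal n S0 ∧ S = push n x S0
  | (x, false) :: w, S => Normal n S ∧ Reach n w (push n x S)

theorem reach_nice (hn : NN n) (w : List Ltr) (hw : Nice n w) :
    ∃ S, Reach n w S ∧ Normal n S ∧ Inv n w S := by
  induction w with
  | nil => exact ⟨[], rfl, trivial, Inv.nil⟩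
  | cons l w ih =>
    obtain ⟨S, hR, hS, hI⟩ := ih (Nice.suffix (A := [l]) hw)
    have hw' : Nice n w := (Nice.suffix (A := [l]) hw)
    obtain ⟨z, s⟩ := l
    cases s with
    | true =>
      rcases invB hn z hw' hI with h | ⟨w', rfl⟩
      · exact ⟨(z, true) :: S, ⟨S, hR, hS, (push_cons h).symm⟩, ⟨h, hS⟩, Inv.pos _ _ _ hI⟩
      · exact absurd rfl (hw.red [] w' z true)
    | false =>
      have cons : ok n (z, false) S → ∃ S', Reach n ((z, false) :: w) S' ∧ Normal n S' ∧
          Inv n ((z, false) :: w) S' := by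
        intro h
        refine ⟨(z, false) :: S, ⟨⟨h, hS⟩, by rw [push_cancel]; exact hR⟩, ⟨h, hS⟩,
          Inv.neg _ _ _ hI h⟩
      cases hI with
      | nil => exact cons (by intro y s S' h; simp at h)
      | pos y w S h0 =>
        apply cons
        intro y' s S' h
        simp at h
        obtain ⟨⟨rfl, rfl⟩, -⟩ := h
        refine ⟨rfl, ?_⟩
        rintro rfl
        exact hw.red [] w y false rfl
      | neg y w1 S1 h0 hok =>
        have hN := normal_g hn z hS (normal_push hn z S1 hS.2)
        refine ⟨salt true y z (n z y - 3) ++ push n z S1, ⟨hN, ?_⟩, hN, ?_⟩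
        · rw [push_g hn z hS]; exact hR
        · have hg := hn.ge z y
          apply Inv.run
          rcases invB hn z (Nice.suffix (A := [_]) hw') h0 with h | ⟨w', rfl⟩
          · refine ⟨z, y, 2, w1, S1, le_rfl, rfl, ?_⟩
            have ht := hn.top3 y z
            rw [hn.symm] at ht
            rw [push_cons h, show n z y - 2 = (n z y - 3) + 1 by omega, salt_snoc, ht]
            simp
          · exact ⟨z, y, 3, w', _, by omega, rfl, rfl⟩
      | run _ _ h =>
        obtain ⟨p, q, k, w', S', hk, hw0, hS0⟩ := h
        have hlt := hw'.lt (A := []) hw0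
        by_cases hzq : z = q
        · subst hzq
          obtain ⟨m, hm⟩ : ∃ m, n p z - k = m + 1 := ⟨n p z - k - 1, by omega⟩
          rw [hm, salt, List.cons_append] at hS0
          subst hS0
          refine ⟨salt true p z m ++ S', ⟨hS.2, ?_⟩, hS.2, ?_⟩
          · rw [push_cons hS.1]; exact hR
          · apply Inv.run
            refine ⟨z, p, k + 1, w', S', by omega, by rw [hw0]; rfl, ?_⟩
            rw [hn.symm z p, show n p z - (k + 1) = m by omega]
        · apply cons
          rw [salt_two _ _ _ (by omega)] at hS0
          intro y s S'' h
          rw [hS0] at h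
          simp at h
          obtain ⟨⟨rfl, rfl⟩, -⟩ := h
          exact ⟨rfl, fun h => hzq h.symm⟩

theorem reach_ne (hn : NN n) (w : List Ltr) (hw : Nice n w) (h0 : w ≠ []) :
    ∃ S, Reach n w S ∧ Normal n S ∧ S ≠ [] := by
  obtain ⟨S, hR, hS, hI⟩ := reach_nice hn w hw
  refine ⟨S, hR, hS, ?_⟩
  cases hI with
  | nil => exact absurd rfl h0
  | pos => simp
  | neg => simp
  | run _ _ h =>
    obtain ⟨p, q, k, w', S', hk, hw0, hS0⟩ := h
    have hlt := hw.lt (A := []) hw0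
    rw [salt_two _ _ _ (by omega)] at hS0
    simp [hS0]

/-! ### The action of the group -/

/-- Push as a permutation of normal stacks. -/
noncomputable def pperm (hn : NN n) (a : ℕ) : Equiv.Perm {S : List Ltr // Normal n S} :=
  Equiv.ofBijective (fun S => ⟨push n a S.1, normal_push hn a S.1 S.2⟩) (by
    have h7 := hn.self a
    have hr : ∀ k (S : List Ltr), Normal n S → Normal n (runs n a a k S) := by
      intro k
      induction k with
      | zero => intro S h; exact h
      | succ k ih => intro S h; exact ih _ (normal_push hn a S h)
    constructor
    · intro S S' h
      have h1 : push n a S.1 = push n a S'.1 := congrArg Subtype.val h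
      apply Subtype.ext
      rw [← runs_rel hn a a S.1 S.2, ← runs_rel hn a a S'.1 S'.2, h7]
      show runs n a a 6 (push n a S.1) = runs n a a 6 (push n a S'.1)
      rw [h1]
    · intro S
      refine ⟨⟨runs n a a 6 S.1, hr _ _ S.2⟩, ?_⟩
      apply Subtype.ext
      show push n a (runs n a a 6 S.1) = S.1
      have := runs_succ (n := n) a a 6 S.1
      rw [top_self] at this
      rw [← this, show 6 + 1 = n a a by rw [h7], runs_rel hn a a S.1 S.2])

theorem pperm_val (hn : NN n) (a : ℕ) (S) : (pperm hn a S).1 = push n a S.1 := rfl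

theorem pperm_pow (hn : NN n) (a b m : ℕ) (S) :
    (((pperm hn a * pperm hn b) ^ m) S).1 = runs n b a (2 * m) S.1 := by
  induction m generalizing S with
  | zero => rfl
  | succ m ih =>
    rw [pow_succ, Equiv.Perm.mul_apply, ih]
    rfl

theorem pperm_rel (hn : NN n) (a b m : ℕ) (h : n a b = 2 * m) :
    (pperm hn a * pperm hn b) ^ m = 1 := by
  ext1 S
  apply Subtype.ext
  rw [pperm_pow, ← h, hn.symm, runs_rel hn _ _ _ S.2]
  rfl

theorem pperm_seven (hn : NN n) (a : ℕ) : pperm hn a ^ 7 = 1 := by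
  ext1 S
  apply Subtype.ext
  have : ∀ k S, ((pperm hn a ^ k) S).1 = runs n a a k S.1 := by
    intro k
    induction k with
    | zero => intro S; rfl
    | succ k ih => intro S; rw [pow_succ, Equiv.Perm.mul_apply, ih]; rfl
  rw [this, ← hn.self a, runs_rel hn _ _ _ S.2]
  rfl

open Classical in
/-- The relator lengths of `G_T`. -/
noncomputable def nT (T : SimpleGraph ℕ) (a b : ℕ) : ℕ :=
  if a = b then 7 else if T.Adj a b then 22 else 26

theorem nT_NN (T : SimpleGraph ℕ) : NN (nT T) := by
  refine ⟨fun a b => ?_, fun a => ?_, fun a b h => ?_⟩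
  · by_cases h : a = b
    · subst h; rfl
    · by_cases h' : T.Adj a b
      · simp [nT, h, Ne.symm h, h', h'.symm]
      · have h'' : ¬ T.Adj b a := fun e => h' e.symm
        simp [nT, h, Ne.symm h, h', h'']
  · simp [nT]
  · unfold nT; rw [if_neg h]; split_ifs <;> simp

variable {T : SimpleGraph ℕ}

theorem rel_hom (T : SimpleGraph ℕ) {G : Type*} [Group G] (f : ℕ → G) (h7 : ∀ i, f i ^ 7 = 1)
    (h11 : ∀ i j, T.Adj i j → (f i * f j) ^ 11 = 1)
    (h13 : ∀ i j, i ≠ j → ¬ T.Adj i j → (f i * f j) ^ 13 = 1) :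
    ∀ r ∈ grRels T.Adj, FreeGroup.lift f r = 1 := by
  rintro r (⟨i, rfl⟩ | ⟨i, j, h, rfl⟩ | ⟨i, j, hij, h, rfl⟩)
  · simp [h7]
  · simp [h11 i j h]
  · simp [h13 i j hij h]

/-- The action on normal stacks. -/
noncomputable def act (T : SimpleGraph ℕ) : GT T.Adj →* Equiv.Perm {S // Normal (nT T) S} :=
  PresentedGroup.toGroup (f := pperm (nT_NN T)) (rel_hom T _ (pperm_seven _)
    (fun i j h => pperm_rel _ _ _ _ (by simp [nT, h, T.ne_of_adj h]))
    (fun i j hij h => pperm_rel _ _ _ _ (by simp [nT, h, hij])))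

theorem act_gen (i : ℕ) : act T (gen T.Adj i) = pperm (nT_NN T) i :=
  PresentedGroup.toGroup.of _

/-- Value of a letter. -/
def lval (T : SimpleGraph ℕ) (l : Ltr) : GT T.Adj :=
  if l.2 then gen T.Adj l.1 else (gen T.Adj l.1)⁻¹

/-- Value of a word. -/
def val (T : SimpleGraph ℕ) (w : List Ltr) : GT T.Adj := (w.map (lval T)).prod

theorem val_nil : val T [] = 1 := rfl

theorem val_cons (l : Ltr) (w) : val T (l :: w) = lval T l * val T w := by simp [val]

theorem val_append (v w) : val T (v ++ w) = val T v * val T w := by simp [val]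

theorem act_val (w : List Ltr) (S : List Ltr) (hS : Normal (nT T) S) (h : Reach (nT T) w S) :
    act T (val T w) ⟨[], trivial⟩ = ⟨S, hS⟩ := by
  induction w generalizing S with
  | nil => obtain rfl : S = [] := h; simp [val_nil]
  | cons l w ih =>
    obtain ⟨x, s⟩ := l
    cases s with
    | true =>
      obtain ⟨S0, h0, hS0, rfl⟩ := h
      rw [val_cons, map_mul, Equiv.Perm.mul_apply, ih S0 hS0 h0]
      simp only [lval, if_true, act_gen]
      rfl
    | false =>
      obtain ⟨_, h0⟩ := h
      rw [val_cons, map_mul, Equiv.Perm.mul_apply, ih _ (normal_push (nT_NN T) x S hS) h0]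
      simp only [lval, Bool.false_eq_true, if_false, map_inv, act_gen]
      rw [Equiv.Perm.inv_eq_iff_eq]
      rfl

/-- The Dehn type lemma. -/
theorem nice_ne_one (w : List Ltr) (hw : Nice (nT T) w) (h0 : w ≠ []) : val T w ≠ 1 := by
  intro h
  obtain ⟨S, hR, hS, hne⟩ := reach_ne (nT_NN T) w hw h0
  have := act_val w S hS hR
  rw [h, map_one] at this
  exact hne (congrArg Subtype.val this).symm

end WG

namespace WG

variable {n : ℕ → ℕ → ℕ} {T : SimpleGraph ℕ}

theorem salt_get (s : Bool) (a b k t : ℕ) (h : t < k) :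
    (salt s a b k)[t]? = some (top a b t, s) := by
  induction k generalizing a b t with
  | zero => omega
  | succ k ih =>
    cases t with
    | zero => simp [salt, top]
    | succ t => rw [salt, List.getElem?_cons_succ, ih _ _ _ (by omega), top_succ]

theorem nice_of_index {w : List Ltr}
    (h1 : ∀ i x s, w[i]? = some (x, s) → w[i + 1]? = some (x, !s) → False)
    (h2 : ∀ s a b i, (∀ t < n a b - 3, w[i + t]? = some (top a b t, s)) → False) : Nice n w := by
  constructor
  · rintro A B x s rfl
    apply h1 A.length x s
    · simp
    · simp
  · rintro s a b A B rfl
    apply h2 s a b A.length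
    intro t ht
    rw [List.getElem?_append_right (by omega), Nat.add_sub_cancel_left,
      List.getElem?_append_left (by rw [salt_length]; exact ht), salt_get _ _ _ _ _ ht]

/-- A window at the beginning of a list. -/
theorem eq_salt_append {s : Bool} {k : ℕ} : ∀ {a b : ℕ} {w : List Ltr},
    (∀ t < k, w[t]? = some (top a b t, s)) → ∃ B, w = salt s a b k ++ B := by
  induction k with
  | zero => intro a b w _; exact ⟨w, rfl⟩
  | succ k ih =>
    intro a b w h
    rcases w with _ | ⟨l, w⟩
    · have := h 0 (by omega); simp at this
    · have h0 := h 0 (by omega)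
      simp [top] at h0
      obtain ⟨B, rfl⟩ := ih (a := b) (b := a) (w := w) (fun t ht => by
        have := h (t + 1) (by omega)
        rw [top_succ, List.getElem?_cons_succ] at this
        exact this)
      exact ⟨B, by rw [h0]; rfl⟩

/-! ### Inverse words -/

/-- Formal inverse of a word. -/
def invw (w : List Ltr) : List Ltr := (w.map (fun l => (l.1, !l.2))).reverse

theorem invw_length (w : List Ltr) : (invw w).length = w.length := by simp [invw]

theorem lval_inv (x : ℕ) (s : Bool) : lval T (x, !s) = (lval T (x, s))⁻¹ := by
  cases s <;> simp [lval]

theorem val_invw (w : List Ltr) : val T (invw w) = (val T w)⁻¹ := by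
  induction w with
  | nil => simp [invw, val]
  | cons l w ih =>
    have : invw (l :: w) = invw w ++ [(l.1, !l.2)] := by simp [invw]
    rw [this, val_append, ih, val_cons, val_cons, mul_inv_rev, val_nil, mul_one, lval_inv]

/-! ### Relations -/

theorem gen_seven (i : ℕ) : gen T.Adj i ^ 7 = 1 := by
  have : PresentedGroup.mk (grRels T.Adj) (FreeGroup.of i ^ 7) = 1 :=
    PresentedGroup.one_of_mem (Or.inl ⟨i, rfl⟩)
  rw [map_pow] at this
  try rw [map_mul] at this
  exact this

theorem gen_eleven {i j : ℕ} (h : T.Adj i j) : (gen T.Adj i * gen T.Adj j) ^ 11 = 1 := by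
  have : PresentedGroup.mk (grRels T.Adj) ((FreeGroup.of i * FreeGroup.of j) ^ 11) = 1 :=
    PresentedGroup.one_of_mem (Or.inr (Or.inl ⟨i, j, h, rfl⟩))
  rw [map_pow] at this
  try rw [map_mul] at this
  exact this

theorem gen_thirteen {i j : ℕ} (hij : i ≠ j) (h : ¬ T.Adj i j) :
    (gen T.Adj i * gen T.Adj j) ^ 13 = 1 := by
  have : PresentedGroup.mk (grRels T.Adj) ((FreeGroup.of i * FreeGroup.of j) ^ 13) = 1 :=
    PresentedGroup.one_of_mem (Or.inr (Or.inr ⟨i, j, hij, h, rfl⟩))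
  rw [map_pow] at this
  try rw [map_mul] at this
  exact this

theorem lval_seven (i : ℕ) (s : Bool) : lval T (i, s) ^ 7 = 1 := by
  cases s <;> simp [lval, gen_seven]

theorem lval_pow_inv {i j m : ℕ} (h : (gen T.Adj j * gen T.Adj i) ^ m = 1)
    (h' : (gen T.Adj i * gen T.Adj j) ^ m = 1) (s : Bool) :
    (lval T (i, s) * lval T (j, s)) ^ m = 1 := by
  cases s
  · simp only [lval, Bool.false_eq_true, if_false]
    rw [← mul_inv_rev, inv_pow, h, inv_one]
  · simpa [lval] using h'

theorem lval_eleven {i j : ℕ} (h : T.Adj i j) (s : Bool) :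
    (lval T (i, s) * lval T (j, s)) ^ 11 = 1 :=
  lval_pow_inv (gen_eleven h.symm) (gen_eleven h) s

theorem lval_thirteen {i j : ℕ} (hij : i ≠ j) (h : ¬ T.Adj i j) (s : Bool) :
    (lval T (i, s) * lval T (j, s)) ^ 13 = 1 :=
  lval_pow_inv (gen_thirteen hij.symm (fun e => h e.symm)) (gen_thirteen hij h) s

theorem val_salt_even (s : Bool) (a b m : ℕ) :
    val T (salt s a b (2 * m)) = (lval T (a, s) * lval T (b, s)) ^ m := by
  induction m with
  | zero => simp [salt, val]
  | succ m ih =>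
    rw [show 2 * (m + 1) = 2 * m + 1 + 1 by omega, salt, salt, val_cons, val_cons, ih, pow_succ',
      mul_assoc]

theorem val_salt_self (s : Bool) (a m : ℕ) :
    val T (salt s a a m) = lval T (a, s) ^ m := by
  induction m with
  | zero => simp [salt, val]
  | succ m ih => rw [salt, val_cons, ih, pow_succ']

theorem val_rel (s : Bool) (a b : ℕ) : val T (salt s a b (nT T a b)) = 1 := by
  by_cases hab : a = b
  · subst hab
    rw [val_salt_self]; simp [nT, lval_seven]
  · by_cases h : T.Adj a b
    · rw [show nT T a b = 2 * 11 by simp [nT, hab, h], val_salt_even, lval_eleven h]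
    · rw [show nT T a b = 2 * 13 by simp [nT, hab, h], val_salt_even, lval_thirteen hab h]

theorem val_replace (s : Bool) (a b k : ℕ) (hk : k ≤ nT T a b) :
    ∃ M, M.length = nT T a b - k ∧ val T M = val T (salt s a b k) := by
  refine ⟨invw (salt s (top a b k) (top b a k) (nT T a b - k)), ?_, ?_⟩
  · rw [invw_length, salt_length]
  · rw [val_invw, inv_eq_iff_mul_eq_one]
    have := val_rel (T := T) s a b
    rw [show nT T a b = k + (nT T a b - k) by omega, salt_add, val_append] at this
    exact mul_eq_one_comm.mp this

theorem val_surj (g : GT T.Adj) : ∃ L, val T L = g := by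
  induction g using PresentedGroup.induction_on with
  | _ z =>
  induction z using FreeGroup.induction_on with
  | C1 => exact ⟨[], by rw [val_nil, map_one]⟩
  | of i => exact ⟨[(i, true)], by simp [val, lval, gen]; rfl⟩
  | inv_of i h => exact ⟨[(i, false)], by simp [val, lval, gen]; rfl⟩
  | mul x y hx hy =>
    obtain ⟨L, hL⟩ := hx
    obtain ⟨M, hM⟩ := hy
    exact ⟨L ++ M, by rw [val_append, hL, hM, map_mul]⟩

/-! ### Periodic words -/

/-- Periodic word. -/
def per (L : List Ltr) : ℕ → List Ltr
  | 0 => []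
  | q + 1 => L ++ per L q

theorem val_per (L : List Ltr) (q : ℕ) : val T (per L q) = val T L ^ q := by
  induction q with
  | zero => simp [per, val]
  | succ q ih => rw [per, val_append, ih, pow_succ']

theorem per_get (L : List Ltr) (q i : ℕ) (l : Ltr) (h : (per L q)[i]? = some l) :
    L[i % L.length]? = some l := by
  induction q generalizing i with
  | zero => simp [per] at h
  | succ q ih =>
    rw [per] at h
    by_cases hi : i < L.length
    · rw [List.getElem?_append_left hi] at h
      rw [Nat.mod_eq_of_lt hi]; exact h
    · push Not at hi
      rw [List.getElem?_append_right hi] at h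
      have := ih _ h
      rwa [Nat.mod_eq_sub_mod hi]

theorem per_ne {L : List Ltr} (h : L ≠ []) {q : ℕ} (hq : 1 ≤ q) : per L q ≠ [] := by
  obtain ⟨u, rfl⟩ := Nat.exists_eq_add_of_le' hq
  simp [per, h]

/-- Niceness of periodic words, cyclic index version. -/
theorem nice_per {L : List Ltr} (q : ℕ) (hL : L ≠ [])
    (h1 : ∀ j < L.length, ∀ x s, L[j % L.length]? = some (x, s) →
      L[(j + 1) % L.length]? = some (x, !s) → False)
    (h2 : ∀ s a b, ∀ j < L.length, (∀ t < n a b - 3, L[(j + t) % L.length]? = some (top a b t, s))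
      → False) : Nice n (per L q) := by
  have hp : 0 < L.length := List.length_pos_of_ne_nil hL
  apply nice_of_index
  · intro i x s e1 e2
    apply h1 (i % L.length) (Nat.mod_lt _ hp) x s
    · rw [Nat.mod_mod]; exact per_get _ _ _ _ e1
    · rw [Nat.mod_add_mod]; exact per_get _ _ _ _ e2
  · intro s a b i e
    apply h2 s a b (i % L.length) (Nat.mod_lt _ hp)
    intro t ht
    rw [Nat.mod_add_mod]; exact per_get _ _ _ _ (e t ht)

/-! ### Small nice words -/

theorem lval_ne_one (l : Ltr) : lval T l ≠ 1 := by
  have hn := nT_NN T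
  have : Nice (nT T) [l] := by
    apply nice_of_index
    · intro i x s _ h2
      simp at h2
    · intro s a b i h
      have := h 1 (by have := hn.ge a b; omega)
      simp at this
  have := nice_ne_one _ this (by simp)
  simpa [val] using this

theorem pair_ne {c d : ℕ} (h : c ≠ d) (s t : Bool) : lval T (c, s) * lval T (d, t) ≠ 1 := by
  have hn := nT_NN T
  have : Nice (nT T) [(c, s), (d, t)] := by
    apply nice_of_index
    · intro i x u h1 h2
      rcases i with _ | i
      · simp at h1 h2; exact h (h1.1.trans h2.1.symm)
      · simp at h2
    · intro s a b i h
      have := h 2 (by have := hn.ge a b; omega)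
      simp at this
  have := nice_ne_one _ this (by simp)
  simpa [val] using this

theorem coprime_one {G : Type*} [Group G] {x : G} {p q : ℕ} (hp : x ^ p = 1) (hq : x ^ q = 1)
    (h : Nat.Coprime p q) : x = 1 := by
  have h1 := orderOf_dvd_of_pow_eq_one hp
  have h2 := orderOf_dvd_of_pow_eq_one hq
  rw [← orderOf_eq_one_iff]
  exact Nat.dvd_one.mp (h ▸ Nat.dvd_gcd h1 h2)

/-! ### Elements of order seven -/

theorem val_rotate (L : List Ltr) (i : ℕ) : ∃ g, val T (L.rotate i) = g * val T L * g⁻¹ := by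
  have hr : L.rotate i = L.drop (i % L.length) ++ L.take (i % L.length) :=
    List.rotate_eq_drop_append_take_mod
  refine ⟨val T (L.drop (i % L.length)), ?_⟩
  rw [hr, val_append]
  conv_rhs => rw [← List.take_append_drop (i % L.length) L]
  rw [val_append]
  simp only [List.take_append_drop]
  group

theorem F1 (x : GT T.Adj) (h7 : x ^ 7 = 1) (hx : x ≠ 1) :
    ∃ g s a p, 1 ≤ p ∧ p ≤ 3 ∧ x = g * val T (salt s a a p) * g⁻¹ := by
  classical
  have hn := nT_NN T
  have hex : ∃ m, ∃ L : List Ltr, L.length = m ∧ ∃ g, val T L = g * x * g⁻¹ := by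
    obtain ⟨L, h⟩ := val_surj x
    exact ⟨_, L, rfl, 1, by simp [h]⟩
  obtain ⟨L, hLm, g, hg⟩ := Nat.find_spec hex
  have hmin : ∀ M : List Ltr, (∃ g, val T M = g * x * g⁻¹) → L.length ≤ M.length := by
    intro M hM
    rw [hLm]
    exact Nat.find_min' hex ⟨M, rfl, hM⟩
  have hrot : ∀ i, ∃ g, val T (L.rotate i) = g * x * g⁻¹ := by
    intro i
    obtain ⟨g', h'⟩ := val_rotate (T := T) L i
    exact ⟨g' * g, by rw [h', hg]; group⟩
  have hL : L ≠ [] := by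
    rintro rfl
    rw [val_nil] at hg
    apply hx
    exact conj_eq_one_iff.mp hg.symm
  have hp : 0 < L.length := List.length_pos_of_ne_nil hL
  by_contra hcon
  have hnice : Nice (nT T) (per L 7) := by
    apply nice_per _ hL
    · intro j hj y s e1 e2
      by_cases hp1 : L.length = 1
      · rw [hp1, Nat.mod_one] at e1 e2
        rw [e1] at e2
        simp at e2
      · rw [Nat.mod_eq_of_lt hj] at e1
        have e1' : (L.rotate j)[0]? = some (y, s) := by
          rw [List.getElem?_rotate (by omega), Nat.zero_add, Nat.mod_eq_of_lt hj]; exact e1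
        have e2' : (L.rotate j)[1]? = some (y, !s) := by
          rw [List.getElem?_rotate (by omega), Nat.add_comm]; exact e2
        have hlen : (L.rotate j).length = L.length := List.length_rotate _ _
        obtain ⟨g', hg'⟩ := hrot j
        rcases hM : L.rotate j with _ | ⟨l, _ | ⟨l', M⟩⟩
        · rw [hM] at e1'; simp at e1'
        · rw [hM] at e2'; simp at e2'
        · rw [hM] at e1' e2' hg' hlen
          simp at e1' e2'
          subst e1' e2'
          have := hmin M ⟨g', by
            rw [← hg', val_cons, val_cons, lval_inv]; group⟩
          simp at hlen
          omega
    · intro s a b j hj e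
      obtain ⟨g', hg'⟩ := hrot j
      have hlen : (L.rotate j).length = L.length := List.length_rotate _ _
      have hge := hn.ge a b
      by_cases hN : nT T a b - 3 ≤ L.length
      · obtain ⟨M, hM⟩ := eq_salt_append (s := s) (k := nT T a b - 3) (a := a) (b := b)
          (w := L.rotate j) (by
            intro t ht
            rw [List.getElem?_rotate (by omega), Nat.add_comm]; exact e t ht)
        obtain ⟨M', hM', hv⟩ := val_replace (T := T) s a b (nT T a b - 3) (by omega)
        rw [hM] at hlen hg'
        have := hmin (M' ++ M) ⟨g', by rw [← hg', val_append, val_append, hv]⟩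
        simp [salt_length] at hlen this
        omega
      · push Not at hN
        obtain ⟨M, hM⟩ := eq_salt_append (s := s) (k := L.length) (a := a) (b := b)
          (w := L.rotate j) (by
            intro t ht
            rw [List.getElem?_rotate (by omega), Nat.add_comm]; exact e t (by omega))
        have hM0 : M = [] := by
          rw [hM] at hlen
          simp [salt_length] at hlen
          exact hlen
        rw [hM0, List.append_nil] at hM
        have hpar : top a b L.length = a := by
          have h0 := e 0 (by omega)
          have h1 := e L.length (by omega)
          rw [Nat.add_mod_right] at h1
          rw [Nat.add_zero, h1] at h0
          simpa [top] using h0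
        rw [hM] at hg'
        have hx' : x = g'⁻¹ * val T (salt s a b L.length) * g'⁻¹⁻¹ := by rw [hg']; group
        by_cases hab : a = b
        · subst hab
          have := hn.self a
          exact hcon ⟨g'⁻¹, s, a, L.length, hp, by omega, hx'⟩
        · have hev : L.length % 2 = 0 := by
            by_contra h
            unfold top at hpar
            rw [if_neg h] at hpar
            exact hab hpar.symm
          obtain ⟨m, hm⟩ : ∃ m, L.length = 2 * m := ⟨L.length / 2, by omega⟩
          rw [hm, val_salt_even] at hx'
          apply hx
          have hpow : ∀ q, (lval T (a, s) * lval T (b, s)) ^ q = 1 → x ^ q = 1 := by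
            intro q hq
            rw [hx', conj_pow, ← pow_mul, mul_comm m q, pow_mul, hq]
            simp
          by_cases hadj : T.Adj a b
          · exact coprime_one h7 (hpow 11 (lval_eleven hadj s)) (by norm_num)
          · exact coprime_one h7 (hpow 13 (lval_thirteen hab hadj s)) (by norm_num)
  refine nice_ne_one _ hnice (per_ne hL (by norm_num)) ?_
  rw [val_per, hg, conj_pow, h7]
  simp

end WG

namespace WG

variable {T : SimpleGraph ℕ}

/-- Geodesic words. -/
def Geo (T : SimpleGraph ℕ) (L : List Ltr) : Prop :=
  ∀ M, val T M = val T L → L.length ≤ M.length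

theorem geo_red {L : List Ltr} (h : Geo T L) (i x : ℕ) (s : Bool) (e1 : L[i]? = some (x, s))
    (e2 : L[i + 1]? = some (x, !s)) : False := by
  have hL := List.take_append_drop i L
  have e1' : (L.drop i)[0]? = some (x, s) := by rw [List.getElem?_drop]; exact e1
  have e2' : (L.drop i)[1]? = some (x, !s) := by rw [List.getElem?_drop]; exact e2
  rcases hM : L.drop i with _ | ⟨l, _ | ⟨l', M⟩⟩
  · rw [hM] at e1'; simp at e1'
  · rw [hM] at e2'; simp at e2'
  · rw [hM] at e1' e2'
    simp at e1' e2'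
    subst e1' e2'
    rw [hM] at hL
    have h1 := h (L.take i ++ M) (by
      conv_rhs => rw [← hL]
      rw [val_append, val_append, val_cons, val_cons, lval_inv]
      group)
    have h2 := congrArg List.length hL
    simp only [List.length_append, List.length_cons] at h1 h2
    omega

theorem geo_win {L : List Ltr} (h : Geo T L) (i a b k : ℕ) (s : Bool) (hk : k ≤ nT T a b)
    (hk2 : nT T a b < 2 * k) (e : ∀ t < k, L[i + t]? = some (top a b t, s)) : False := by
  have hL := List.take_append_drop i L
  obtain ⟨M, hM⟩ := eq_salt_append (s := s) (k := k) (a := a) (b := b) (w := L.drop i) (by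
    intro t ht
    rw [List.getElem?_drop]; exact e t ht)
  obtain ⟨M', hM', hv⟩ := val_replace (T := T) s a b k hk
  rw [hM] at hL
  have h1 := h (L.take i ++ (M' ++ M)) (by
    conv_rhs => rw [← hL]
    rw [val_append, val_append, val_append, val_append, hv])
  have h2 := congrArg List.length hL
  simp only [List.length_append, salt_length] at h1 h2
  omega

theorem geo_inv {L : List Ltr} (h : Geo T L) : Geo T (invw L) := by
  intro M hM
  rw [invw_length, ← invw_length M]
  apply h
  rw [val_invw, hM, val_invw, inv_inv]

theorem top_ne {a b : ℕ} (h : a ≠ b) (t : ℕ) : top a b t ≠ top a b (t + 1) := by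
  rw [top_succ]; unfold top; split_ifs
  · exact h
  · exact h.symm

theorem cyc_nice {L : List Ltr} (hL : Geo T L) (hne : L ≠ []) {a b p q : ℕ} {s t : Bool}
    (hp : 1 ≤ p) (hp3 : p ≤ 3) (hq : 1 ≤ q) (hq3 : q ≤ 3)
    (ha : ∀ x u, L[0]? = some (x, u) → x ≠ a)
    (hb : ∀ x u, L[L.length - 1]? = some (x, u) → x ≠ b) (e : ℕ) :
    Nice (nT T) (per (salt s a a p ++ (L ++ (salt t b b q ++ invw L))) e) := by
  have hn := nT_NN T
  have hL' := geo_inv hL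
  obtain ⟨m, hm⟩ : ∃ m, L.length = m := ⟨_, rfl⟩
  have hm0 : 0 < m := hm ▸ List.length_pos_of_ne_nil hne
  obtain ⟨⟨x0, s0⟩, hx0⟩ : ∃ l, L[0]? = some l := ⟨L[0], by simp⟩
  obtain ⟨⟨x1, s1⟩, hx1⟩ : ∃ l, L[m - 1]? = some l := ⟨L[m - 1], by simp⟩
  have hxa := ha _ _ hx0
  rw [hm] at hb
  have hxb := hb _ _ hx1
  have hy0 : (invw L)[m - 1]? = some (x0, !s0) := by
    unfold invw
    rw [List.getElem?_reverse (by simp; omega)]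
    simp only [List.length_map, hm, List.getElem?_map]
    rw [show m - 1 - (m - 1) = 0 by omega, hx0]; rfl
  have hy1 : (invw L)[0]? = some (x1, !s1) := by
    unfold invw
    rw [List.getElem?_reverse (by simp; omega)]
    simp only [List.length_map, hm, List.getElem?_map]
    rw [show m - 1 - 0 = m - 1 by omega, hx1]; rfl
  have hm' : (invw L).length = m := by rw [invw_length, hm]
  generalize hLL : invw L = L' at *
  set W := salt s a a p ++ (L ++ (salt t b b q ++ L')) with hW
  have hlen : W.length = p + m + q + m := by
    simp [hW, salt_length, hm, hm']; omega
  have gA : ∀ i < p, W[i]? = some (a, s) := by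
    intro i hi
    rw [hW, List.getElem?_append_left (by rw [salt_length]; omega), salt_get _ _ _ _ _ hi, top_self]
  have gL : ∀ i < m, W[p + i]? = L[i]? := by
    intro i hi
    rw [hW, List.getElem?_append_right (by rw [salt_length]; omega), salt_length,
      List.getElem?_append_left (by omega)]
    congr 1; omega
  have gB : ∀ i < q, W[p + m + i]? = some (b, t) := by
    intro i hi
    rw [hW, List.getElem?_append_right (by rw [salt_length]; omega), salt_length,
      List.getElem?_append_right (by omega), List.getElem?_append_left (by rw [salt_length]; omega),
      show p + m + i - p - L.length = i by omega, salt_get _ _ _ _ _ hi, top_self]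
  have gM : ∀ i < m, W[p + m + q + i]? = L'[i]? := by
    intro i hi
    rw [hW, List.getElem?_append_right (by rw [salt_length]; omega), salt_length,
      List.getElem?_append_right (by omega), List.getElem?_append_right (by rw [salt_length]; omega),
      salt_length]
    congr 1; omega
  clear_value W
  rw [show per W e = per W e from rfl]
  have hF1 : ∀ i < p + m + q + m, i % W.length = i := fun i hi => by
    rw [hlen]; exact Nat.mod_eq_of_lt hi
  have hF2 : ∀ i < p + m + q + m, (p + m + q + m + i) % W.length = i := fun i hi => by
    rw [hlen, Nat.add_mod_left]; exact Nat.mod_eq_of_lt hi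
  have fA : ∀ i < p, W[i % W.length]? = some (a, s) := fun i hi => by
    rw [hF1 i (by omega)]; exact gA i hi
  have fL : ∀ i < m, W[(p + i) % W.length]? = L[i]? := fun i hi => by
    rw [hF1 _ (by omega)]; exact gL i hi
  have fB : ∀ i < q, W[(p + m + i) % W.length]? = some (b, t) := fun i hi => by
    rw [hF1 _ (by omega)]; exact gB i hi
  have fM : ∀ i < m, W[(p + m + q + i) % W.length]? = L'[i]? := fun i hi => by
    rw [hF1 _ (by omega)]; exact gM i hi
  have fA2 : ∀ i < p, W[(p + m + q + m + i) % W.length]? = some (a, s) := fun i hi => by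
    rw [hF2 _ (by omega)]; exact gA i hi
  have fL2 : W[(p + m + q + m + p) % W.length]? = some (x0, s0) := by
    rw [hF2 _ (by omega), ← hx0]; exact gL 0 hm0
  have fx0 : W[p % W.length]? = some (x0, s0) := (fL 0 hm0).trans hx0
  have fx1 : W[(p + m - 1) % W.length]? = some (x1, s1) := by
    rw [← hx1, ← fL (m - 1) (by omega)]; congr 2; omega
  have fy0 : W[(p + m + q + m - 1) % W.length]? = some (x0, !s0) := by
    rw [← hy0, ← fM (m - 1) (by omega)]; congr 2; omega
  have fy1 : W[(p + m + q) % W.length]? = some (x1, !s1) := (fM 0 hm0).trans hy1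
  have hWne : W ≠ [] := by rintro rfl; simp at hlen; omega
  clear gA gL gB gM hF1 hF2
  apply nice_per _ hWne
  · intro j hj x u e1 e2
    rw [hlen] at hj
    have clash : ∀ {i i' : ℕ} {l l' : Ltr}, i = j → i' = j + 1 → W[i % W.length]? = some l →
        W[i' % W.length]? = some l' → l.1 = l'.1 ∧ l.2 = !l'.2 := by
      rintro i i' l l' rfl rfl h h'
      rw [h] at e1; rw [h'] at e2
      simp at e1 e2
      rw [e1, e2]; simp
    rcases lt_or_ge j p with h | h
    · rcases Nat.lt_or_ge (j + 1) p with h' | h'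
      · have := clash rfl rfl (fA j h) (fA _ h'); simp at this
      · have := clash rfl (show p = j + 1 by omega) (fA j h) fx0
        exact hxa this.1.symm
    rcases lt_or_ge j (p + m) with h1 | h1
    · rcases Nat.lt_or_ge (j + 1) (p + m) with h' | h'
      · have e1' := fL (j - p) (by omega)
        have e2' := fL (j - p + 1) (by omega)
        rw [show p + (j - p) = j by omega, e1] at e1'
        rw [show p + (j - p + 1) = j + 1 by omega, e2] at e2'
        exact geo_red hL _ _ _ e1'.symm e2'.symm
      · have := clash (show p + m - 1 = j by omega) (show p + m + 0 = j + 1 by omega) fx1 (fB 0 hq)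
        exact hxb this.1
    rcases lt_or_ge j (p + m + q) with h2 | h2
    · rcases Nat.lt_or_ge (j + 1) (p + m + q) with h' | h'
      · have := clash (show p + m + (j - (p + m)) = j by omega)
          (show p + m + (j - (p + m) + 1) = j + 1 by omega)
          (fB _ (by omega)) (fB _ (by omega))
        simp at this
      · have := clash (show p + m + (q - 1) = j by omega) (show p + m + q = j + 1 by omega)
          (fB (q - 1) (by omega)) fy1
        exact hxb this.1.symm
    · rcases Nat.lt_or_ge (j + 1) (p + m + q + m) with h' | h'
      · have e1' := fM (j - (p + m + q)) (by omega)
        have e2' := fM (j - (p + m + q) + 1) (by omega)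
        rw [show p + m + q + (j - (p + m + q)) = j by omega, e1] at e1'
        rw [show p + m + q + (j - (p + m + q) + 1) = j + 1 by omega, e2] at e2'
        exact geo_red hL' _ _ _ e1'.symm e2'.symm
      · have := clash (show p + m + q + m - 1 = j by omega) (show p + m + q + m + 0 = j + 1 by omega)
          fy0 (fA2 0 hp)
        exact hxa this.1
  · intro u c d j hj hwin
    rw [hlen] at hj
    have hge := hn.ge c d
    have rd : ∀ {i : ℕ} {l : Ltr}, j ≤ i → i < j + (nT T c d - 3) → W[i % W.length]? = some l →
        l = (top c d (i - j), u) := by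
      intro i l h h' hl
      have := hwin (i - j) (by omega)
      rw [show j + (i - j) = i by omega, hl] at this
      simpa using this
    -- windows inside `L` and inside the inverse
    have wL : ∀ i k, nT T c d < 2 * k → k ≤ nT T c d → j ≤ p + i → p + i + k ≤ j + (nT T c d - 3) →
        i + k ≤ m → False := by
      intro i k h1 h2 h3 h4 h5
      set o := p + i - j with ho
      refine geo_win hL i (top c d o) (top d c o) k u ?_ ?_ ?_
      · unfold top; split_ifs
        · exact h2
        · rw [hn.symm]; exact h2
      · unfold top; split_ifs
        · exact h1
        · rw [hn.symm]; exact h1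
      · intro r hr
        rw [← fL (i + r) (by omega)]
        have := hwin (o + r) (by omega)
        rw [show j + (o + r) = p + (i + r) by omega] at this
        rw [this]
        congr 2
        unfold top
        split_ifs <;> first | rfl | omega
    have wM : ∀ i k, nT T c d < 2 * k → k ≤ nT T c d → j ≤ p + m + q + i →
        p + m + q + i + k ≤ j + (nT T c d - 3) → i + k ≤ m → False := by
      intro i k h1 h2 h3 h4 h5
      set o := p + m + q + i - j with ho
      refine geo_win hL' i (top c d o) (top d c o) k u ?_ ?_ ?_
      · unfold top; split_ifs
        · exact h2
        · rw [hn.symm]; exact h2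
      · unfold top; split_ifs
        · exact h1
        · rw [hn.symm]; exact h1
      · intro r hr
        rw [← fM (i + r) (by omega)]
        have := hwin (o + r) (by omega)
        rw [show j + (o + r) = p + m + q + (i + r) by omega] at this
        rw [this]
        congr 2
        unfold top
        split_ifs <;> first | rfl | omega
    by_cases hcd : c = d
    · subst hcd
      have h7 := hn.self c
      simp only [top_self] at rd
      rcases lt_or_ge j p with h | h
      · have e1 := rd (by omega) (by omega) (fA (p - 1) (by omega))
        have e2 := rd (by omega) (by omega) fx0
        simp at e1 e2
        exact hxa (e2.1.trans e1.1.symm)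
      rcases lt_or_ge j (p + m) with h1 | h1
      · by_cases h' : p + m < j + 4
        · have e1 := rd (by omega) (by omega) fx1
          have e2 := rd (by omega) (by omega) (fB 0 hq)
          simp at e1 e2
          exact hxb (e1.1.trans e2.1.symm)
        · exact wL (j - p) 4 (by omega) (by omega) (by omega) (by omega) (by omega)
      rcases lt_or_ge j (p + m + q) with h2 | h2
      · have e1 := rd (by omega) (by omega) (fB (q - 1) (by omega))
        have e2 := rd (by omega) (by omega) fy1
        simp at e1 e2
        exact hxb (e2.1.trans e1.1.symm)
      · by_cases h' : p + m + q + m < j + 4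
        · have e1 := rd (by omega) (by omega) fy0
          have e2 := rd (by omega) (by omega) (fA2 0 hp)
          simp at e1 e2
          exact hxa (e1.1.trans e2.1.symm)
        · exact wM (j - (p + m + q)) 4 (by omega) (by omega) (by omega) (by omega) (by omega)
    · have hN := hn.ne c d hcd
      rcases lt_or_ge j (p + m) with h1 | h1
      · by_cases h' : p + m + q < j + (nT T c d - 3)
        · have e1 := rd (by omega) (by omega) fx1
          have e2 := rd (by omega) (by omega) fy1
          simp only [Prod.mk.injEq] at e1 e2
          have := e2.2
          rw [e1.2] at this
          simp at this
        · refine wL (max j p - p) (nT T c d - 3 - 6) (by omega) (by omega) (by omega) (by omega)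
            (by omega)
      · by_cases h' : p + m + q + m + p < j + (nT T c d - 3)
        · have e1 := rd (by omega) (by omega) fy0
          have e2 := rd (by omega) (by omega) fL2
          simp only [Prod.mk.injEq] at e1 e2
          have := e1.2
          rw [e2.2] at this
          simp at this
        · refine wM (max j (p + m + q) - (p + m + q)) (nT T c d - 3 - 6) (by omega) (by omega)
            (by omega) (by omega) (by omega)

theorem cyc_nice0 {a b p q : ℕ} {s t : Bool} (hab : a ≠ b)
    (hp : 1 ≤ p) (hp3 : p ≤ 3) (hq : 1 ≤ q) (hq3 : q ≤ 3) (hnot : ¬ (p = 1 ∧ q = 1 ∧ s = t))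
    (e : ℕ) :
    Nice (nT T) (per (salt s a a p ++ salt t b b q) e) := by
  have hn := nT_NN T
  set W := salt s a a p ++ salt t b b q with hW
  have hlen : W.length = p + q := by
    simp [hW, salt_length]
  have gA : ∀ i < p, W[i]? = some (a, s) := by
    intro i hi
    rw [hW, List.getElem?_append_left (by rw [salt_length]; omega), salt_get _ _ _ _ _ hi, top_self]
  have gB : ∀ i < q, W[p + i]? = some (b, t) := by
    intro i hi
    rw [hW, List.getElem?_append_right (by rw [salt_length]; omega), salt_length,
      show p + i - p = i by omega, salt_get _ _ _ _ _ hi, top_self]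
  clear_value W
  have hF1 : ∀ i < p + q, i % W.length = i := fun i hi => by
    rw [hlen]; exact Nat.mod_eq_of_lt hi
  have hF2 : ∀ i < p + q, (p + q + i) % W.length = i := fun i hi => by
    rw [hlen, Nat.add_mod_left]; exact Nat.mod_eq_of_lt hi
  have fA : ∀ i < p, W[i % W.length]? = some (a, s) := fun i hi => by
    rw [hF1 i (by omega)]; exact gA i hi
  have fB : ∀ i < q, W[(p + i) % W.length]? = some (b, t) := fun i hi => by
    rw [hF1 _ (by omega)]; exact gB i hi
  have fA2 : ∀ i < p, W[(p + q + i) % W.length]? = some (a, s) := fun i hi => by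
    rw [hF2 _ (by omega)]; exact gA i hi
  have fB2 : ∀ i < q, W[(p + q + (p + i)) % W.length]? = some (b, t) := fun i hi => by
    rw [hF2 _ (by omega)]; exact gB i hi
  have hWne : W ≠ [] := by rintro rfl; simp at hlen; omega
  apply nice_per _ hWne
  · intro j hj x u e1 e2
    rw [hlen] at hj
    have clash : ∀ {i i' : ℕ} {l l' : Ltr}, i = j → i' = j + 1 → W[i % W.length]? = some l →
        W[i' % W.length]? = some l' → l.1 = l'.1 ∧ l.2 = !l'.2 := by
      rintro i i' l l' rfl rfl h h'
      rw [h] at e1; rw [h'] at e2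
      simp at e1 e2
      rw [e1, e2]; simp
    rcases lt_or_ge j p with h | h
    · rcases Nat.lt_or_ge (j + 1) p with h' | h'
      · have := clash rfl rfl (fA j h) (fA _ h'); simp at this
      · have := clash rfl (show p + 0 = j + 1 by omega) (fA j h) (fB 0 hq)
        exact hab this.1
    · rcases Nat.lt_or_ge (j + 1) (p + q) with h' | h'
      · have := clash (show p + (j - p) = j by omega)
          (show p + (j - p + 1) = j + 1 by omega)
          (fB _ (by omega)) (fB _ (by omega))
        simp at this
      · have := clash (show p + (q - 1) = j by omega) (show p + q + 0 = j + 1 by omega)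
          (fB (q - 1) (by omega)) (fA2 0 hp)
        exact hab this.1.symm
  · intro u c d j hj hwin
    rw [hlen] at hj
    have hge := hn.ge c d
    have rd : ∀ {i : ℕ} {l : Ltr}, j ≤ i → i < j + (nT T c d - 3) → W[i % W.length]? = some l →
        l = (top c d (i - j), u) := by
      intro i l h h' hl
      have := hwin (i - j) (by omega)
      rw [show j + (i - j) = i by omega, hl] at this
      simpa using this
    by_cases hcd : c = d
    · subst hcd
      have h7 := hn.self c
      simp only [top_self] at rd
      rcases lt_or_ge j p with h | h
      · have e1 := rd (by omega) (by omega) (fA (p - 1) (by omega))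
        have e2 := rd (by omega) (by omega) (fB 0 hq)
        simp at e1 e2
        exact hab (e1.1.trans e2.1.symm)
      · have e1 := rd (by omega) (by omega) (fB (q - 1) (by omega))
        have e2 := rd (by omega) (by omega) (fA2 0 hp)
        simp at e1 e2
        exact hab (e2.1.trans e1.1.symm)
    · have hN := hn.ne c d hcd
      have hA := rd (by omega) (by omega) (fA2 0 hp)
      have hB := rd (by omega) (by omega) (fB2 0 hq)
      simp only [Prod.mk.injEq] at hA hB
      apply hnot
      refine ⟨?_, ?_, hA.2.trans hB.2.symm⟩
      · by_contra h
        have hA2 := rd (by omega) (by omega) (fA2 1 (by omega))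
        simp only [Prod.mk.injEq] at hA2
        have := top_ne hcd (p + q + 0 - j)
        rw [show p + q + 0 - j + 1 = p + q + 1 - j by omega] at this
        exact this (hA.1.symm.trans hA2.1)
      · by_contra h
        have hB2 := rd (by omega) (by omega) (fB2 1 (by omega))
        simp only [Prod.mk.injEq] at hB2
        have := top_ne hcd (p + q + (p + 0) - j)
        rw [show p + q + (p + 0) - j + 1 = p + q + (p + 1) - j by omega] at this
        exact this (hB.1.symm.trans hB2.1)

end WG

namespace WG

variable {T : SimpleGraph ℕ}

theorem lval_zpow (a : ℕ) (s : Bool) : ∃ z : ℤ, lval T (a, s) = gen T.Adj a ^ z := by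
  cases s
  · exact ⟨-1, by simp [lval]⟩
  · exact ⟨1, by simp [lval]⟩

theorem salt_zpow (a p : ℕ) (s : Bool) : ∃ z : ℤ, val T (salt s a a p) = gen T.Adj a ^ z := by
  obtain ⟨z, hz⟩ := lval_zpow (T := T) a s
  exact ⟨z * p, by rw [val_salt_self, hz, zpow_mul, zpow_natCast]⟩

theorem zpow_salt (a : ℕ) (z : ℤ) : ∃ s p, p ≤ 3 ∧ gen T.Adj a ^ z = val T (salt s a a p) := by
  have h7 : gen T.Adj a ^ (7 : ℤ) = 1 := by exact_mod_cast gen_seven (T := T) a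
  by_cases h : z % 7 ≤ 3
  · refine ⟨true, (z % 7).toNat, by omega, ?_⟩
    rw [val_salt_self, zpow_eq_zpow_emod z h7, ← zpow_natCast, Int.toNat_of_nonneg (by omega)]
    rfl
  · refine ⟨false, (7 - z % 7).toNat, by omega, ?_⟩
    rw [val_salt_self, zpow_eq_zpow_emod z h7, ← zpow_natCast, Int.toNat_of_nonneg (by omega)]
    simp only [lval, Bool.false_eq_true, if_false]
    rw [inv_zpow', neg_sub, zpow_sub, h7]; simp

theorem F2 {a b p q : ℕ} {s t : Bool} (hp : 1 ≤ p) (hp3 : p ≤ 3) (hq : 1 ≤ q) (hq3 : q ≤ 3)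
    (g : GT T.Adj) {e : ℕ} (he : 1 ≤ e)
    (h : (val T (salt s a a p) * (g * val T (salt t b b q) * g⁻¹)) ^ e = 1) :
    (∃ i j : ℤ, g = gen T.Adj a ^ i * gen T.Adj b ^ j) ∧ (a = b ∨ (p = 1 ∧ q = 1 ∧ s = t)) := by
  classical
  have hex : ∃ m, ∃ L : List Ltr, L.length = m ∧ ∃ i j : ℤ,
      g = gen T.Adj a ^ i * val T L * gen T.Adj b ^ j := by
    obtain ⟨L, h⟩ := val_surj g
    exact ⟨_, L, rfl, 0, 0, by simp [h]⟩
  obtain ⟨L, hLm, i, j, hg⟩ := Nat.find_spec hex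
  have hmin : ∀ M : List Ltr, (∃ i j : ℤ, g = gen T.Adj a ^ i * val T M * gen T.Adj b ^ j) →
      L.length ≤ M.length := by
    intro M hM
    rw [hLm]
    exact Nat.find_min' hex ⟨M, rfl, hM⟩
  obtain ⟨α, hα⟩ := salt_zpow (T := T) a p s
  obtain ⟨β, hβ⟩ := salt_zpow (T := T) b q t
  have hconj : val T (salt s a a p) * (g * val T (salt t b b q) * g⁻¹) =
      gen T.Adj a ^ i * val T (salt s a a p ++ (L ++ (salt t b b q ++ invw L))) *
        (gen T.Adj a ^ i)⁻¹ := by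
    rw [val_append, val_append, val_append, val_invw, hα, hβ, hg]
    group
  rw [hconj, conj_pow, conj_eq_one_iff] at h
  by_cases hL0 : L = []
  · subst hL0
    refine ⟨⟨i, j, by rw [hg, val_nil, mul_one]⟩, ?_⟩
    by_contra hcon
    push Not at hcon
    have hW : salt s a a p ++ ([] ++ (salt t b b q ++ invw [])) = salt s a a p ++ salt t b b q := by
      simp [invw]
    rw [hW] at h
    refine nice_ne_one _ (cyc_nice0 (T := T) (s := s) (t := t) hcon.1 hp hp3 hq hq3
      (fun hh => hcon.2 hh.1 hh.2.1 hh.2.2) e) (per_ne ?_ he) (by rw [val_per, h])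
    intro h0
    have := congrArg List.length h0
    simp [salt_length] at this
    omega
  · exfalso
    have hgeo : Geo T L := by
      intro M hM
      exact hmin M ⟨i, j, by rw [hg, hM]⟩
    refine nice_ne_one _ (cyc_nice (s := s) (t := t) (a := a) (b := b) hgeo hL0 hp hp3 hq hq3
      ?_ ?_ e) (per_ne ?_ he) (by rw [val_per, h])
    · rintro x u hx rfl
      rcases L with _ | ⟨l, M⟩
      · simp at hx
      · simp at hx
        subst hx
        obtain ⟨z, hz⟩ := lval_zpow (T := T) x u
        have := hmin M ⟨i + z, j, by rw [hg, val_cons, hz, zpow_add]; group⟩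
        simp at this
    · rintro x u hx rfl
      rcases List.eq_nil_or_concat L with h0 | ⟨M, l, rfl⟩
      · exact hL0 h0
      · simp at hx
        subst hx
        obtain ⟨z, hz⟩ := lval_zpow (T := T) x u
        have := hmin M ⟨i, z + j, by
          rw [hg, List.concat_eq_append, val_append, val_cons, val_nil, mul_one, hz, zpow_add]
          group⟩
        simp at this
    · intro h0
      have := congrArg List.length h0
      simp [salt_length] at this
      omega

theorem three_one {a b c : ℕ} (hab : a ≠ b) (hbc : b ≠ c) {i j k : ℤ}
    (h : gen T.Adj a ^ i * gen T.Adj b ^ j * gen T.Adj c ^ k = 1) : gen T.Adj b ^ j = 1 := by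
  obtain ⟨s, p, hp, e1⟩ := zpow_salt (T := T) a i
  obtain ⟨t, q, hq, e2⟩ := zpow_salt (T := T) b j
  obtain ⟨u, r, hr, e3⟩ := zpow_salt (T := T) c k
  have hn := nT_NN T
  rcases Nat.eq_zero_or_pos q with rfl | hq0
  · rw [e2]; rfl
  · exfalso
    rw [e1, e2, e3, ← val_append, ← val_append] at h
    refine nice_ne_one _ ?_ ?_ h
    · set W := salt s a a p ++ salt t b b q ++ salt u c c r with hW
      have gA : ∀ i < p, W[i]? = some (a, s) := by
        intro i hi
        rw [hW, List.append_assoc, List.getElem?_append_left (by rw [salt_length]; omega),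
          salt_get _ _ _ _ _ hi, top_self]
      have gB : ∀ i < q, W[p + i]? = some (b, t) := by
        intro i hi
        rw [hW, List.append_assoc, List.getElem?_append_right (by rw [salt_length]; omega),
          salt_length, List.getElem?_append_left (by rw [salt_length]; omega),
          show p + i - p = i by omega, salt_get _ _ _ _ _ hi, top_self]
      have gC : ∀ i < r, W[p + q + i]? = some (c, u) := by
        intro i hi
        rw [hW, List.append_assoc, List.getElem?_append_right (by rw [salt_length]; omega),
          salt_length, List.getElem?_append_right (by rw [salt_length]; omega), salt_length,
          show p + q + i - p - q = i by omega, salt_get _ _ _ _ _ hi, top_self]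
      have hlen : W.length = p + q + r := by simp [hW, salt_length]; omega
      clear_value W
      have hlt : ∀ {i l}, W[i]? = some l → i < p + q + r := by
        intro i l h
        rw [← hlen]
        exact (List.getElem?_eq_some_iff.mp h).1
      have hcls : ∀ i l, W[i]? = some l → (i < p ∧ l = (a, s)) ∨ (p ≤ i ∧ i < p + q ∧ l = (b, t)) ∨
          (p + q ≤ i ∧ l = (c, u)) := by
        intro i l h
        have := hlt h
        rcases lt_or_ge i p with h1 | h1
        · left; rw [gA i h1] at h; simp at h; exact ⟨h1, h.symm⟩
        rcases lt_or_ge i (p + q) with h2 | h2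
        · right; left
          have e := gB (i - p) (by omega)
          rw [show p + (i - p) = i by omega, h] at e
          simp at e; exact ⟨h1, h2, e⟩
        · right; right
          have e := gC (i - (p + q)) (by omega)
          rw [show p + q + (i - (p + q)) = i by omega, h] at e
          simp at e; exact ⟨h2, e⟩
      apply nice_of_index
      · intro i x v h1 h2
        rcases hcls _ _ h1 with ⟨c1, d1⟩ | ⟨c1, c1', d1⟩ | ⟨c1, d1⟩ <;>
        rcases hcls _ _ h2 with ⟨c2, d2⟩ | ⟨c2, c2', d2⟩ | ⟨c2, d2⟩ <;>
        simp only [Prod.mk.injEq] at d1 d2 <;>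
        first
        | omega
        | (have := d2.2; rw [d1.2] at this; simp at this)
      · intro v x y i hwin
        by_cases hxy : x = y
        · subst hxy
          have := hn.self x
          simp only [top_self] at hwin
          have h0 := hwin 0 (by omega)
          have h1 := hwin 1 (by omega)
          have h2 := hwin 2 (by omega)
          have h3 := hwin 3 (by omega)
          rcases hcls _ _ h0 with ⟨c0, d0⟩ | ⟨c0, c0', d0⟩ | ⟨c0, d0⟩
          · have e1 := gA (p - 1) (by omega)
            have e2 := gB 0 hq0
            have f1 := hwin (p - 1 - i) (by omega)
            have f2 := hwin (p - i) (by omega)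
            rw [show i + (p - 1 - i) = p - 1 by omega, e1] at f1
            rw [show i + (p - i) = p + 0 by omega, e2] at f2
            simp at f1 f2
            exact hab (f1.1.trans f2.1.symm)
          · have f2 := hlt h3
            have e1 := gB (q - 1) (by omega)
            have e2 := gC 0 (by omega)
            have f1 := hwin (p + q - 1 - i) (by omega)
            have f2 := hwin (p + q - i) (by omega)
            rw [show i + (p + q - 1 - i) = p + (q - 1) by omega, e1] at f1
            rw [show i + (p + q - i) = p + q + 0 by omega, e2] at f2
            simp at f1 f2
            exact hbc (f1.1.trans f2.1.symm)
          · have := hlt h3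
            omega
        · have := hn.ne x y hxy
          have := hlt (hwin 18 (by omega))
          omega
    · intro h0
      have := congrArg List.length h0
      simp [salt_length] at this
      omega

theorem auto_form (h : GT T.Adj →* GT T.Adj) (hinj : Function.Injective h) :
    ∃ (k : GT T.Adj) (s : Bool) (a : ℕ → ℕ), Function.Injective a ∧
      (∀ i, h (gen T.Adj i) = k * lval T (a i, s) * k⁻¹) ∧
      ∀ i j, T.Adj i j ↔ T.Adj (a i) (a j) := by
  have hgl : ∀ i, gen T.Adj i = lval T (i, true) := fun i => by simp [lval]
  have hF1 : ∀ i, ∃ g s a p, 1 ≤ p ∧ p ≤ 3 ∧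
      h (gen T.Adj i) = g * val T (salt s a a p) * g⁻¹ := by
    intro i
    apply F1
    · rw [← map_pow, gen_seven, map_one]
    · intro h1
      rw [← map_one h] at h1
      have := hinj h1
      rw [hgl] at this
      exact lval_ne_one _ this
  choose g s a p hp hp3 hx using hF1
  have hpow : ∀ i j, i ≠ j → ∃ e, 1 ≤ e ∧ Nat.Coprime 7 e ∧
      (gen T.Adj i * gen T.Adj j) ^ e = 1 := by
    intro i j hij
    by_cases hA : T.Adj i j
    · exact ⟨11, by norm_num, by norm_num, gen_eleven hA⟩
    · exact ⟨13, by norm_num, by norm_num, gen_thirteen hij hA⟩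
  have hne : ∀ i j, i ≠ j → gen T.Adj i * gen T.Adj j ≠ 1 := by
    intro i j hij
    rw [hgl, hgl]; exact pair_ne hij _ _
  have hxy : ∀ i j, i ≠ j → a i ≠ a j ∧ p i = 1 ∧ s i = s j ∧
      ∃ u w : ℤ, g j = g i * (gen T.Adj (a i) ^ u * gen T.Adj (a j) ^ w) := by
    intro i j hij
    obtain ⟨e, he, hco, hpw⟩ := hpow i j hij
    have h1 : (val T (salt (s i) (a i) (a i) (p i)) * ((g i)⁻¹ * g j *
        val T (salt (s j) (a j) (a j) (p j)) * ((g i)⁻¹ * g j)⁻¹)) ^ e = 1 := by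
      have h2 : (h (gen T.Adj i) * h (gen T.Adj j)) ^ e = 1 := by
        rw [← map_mul, ← map_pow, hpw, map_one]
      have h3 : h (gen T.Adj i) * h (gen T.Adj j) = g i *
          (val T (salt (s i) (a i) (a i) (p i)) * ((g i)⁻¹ * g j *
        val T (salt (s j) (a j) (a j) (p j)) * ((g i)⁻¹ * g j)⁻¹)) * (g i)⁻¹ := by
        rw [hx i, hx j]; group
      rwa [h3, conj_pow, conj_eq_one_iff] at h2
    obtain ⟨⟨u, w, huw⟩, hor⟩ := F2 (hp i) (hp3 i) (hp j) (hp3 j) _ he h1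
    have hgg : g j = g i * (gen T.Adj (a i) ^ u * gen T.Adj (a j) ^ w) := by
      rw [← huw]; group
    have hane : a i ≠ a j := by
      intro haa
      obtain ⟨α, hα⟩ := salt_zpow (T := T) (a i) (p i) (s i)
      obtain ⟨β, hβ⟩ := salt_zpow (T := T) (a j) (p j) (s j)
      have h4 : val T (salt (s i) (a i) (a i) (p i)) * ((g i)⁻¹ * g j *
        val T (salt (s j) (a j) (a j) (p j)) * ((g i)⁻¹ * g j)⁻¹) = gen T.Adj (a i) ^ (α + β) := by
        rw [huw, hα, hβ, ← haa]; group
      have h5 : (gen T.Adj (a i) ^ (α + β)) ^ 7 = 1 := by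
        rw [← zpow_natCast, ← zpow_mul, mul_comm, zpow_mul, zpow_natCast, gen_seven, one_zpow]
      rw [h4] at h1
      have h6 := coprime_one h5 h1 hco
      have h7 : h (gen T.Adj i * gen T.Adj j) = 1 := by
        have : h (gen T.Adj i * gen T.Adj j) = g i *
          (val T (salt (s i) (a i) (a i) (p i)) * ((g i)⁻¹ * g j *
        val T (salt (s j) (a j) (a j) (p j)) * ((g i)⁻¹ * g j)⁻¹)) * (g i)⁻¹ := by
          rw [map_mul, hx i, hx j]; group
        rw [this, h4, h6]; simp
      rw [← map_one h] at h7
      exact hne i j hij (hinj h7)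
    rcases hor with hor | hor
    · exact absurd hor hane
    · exact ⟨hane, hor.1, hor.2.2, u, w, hgg⟩
  have hainj : Function.Injective a := by
    intro i j hij
    by_contra hne'
    exact (hxy i j hne').1 hij
  have hp1 : ∀ i, p i = 1 := fun i => (hxy i (i + 1) (by omega)).2.1
  have hs0 : ∀ i, s i = s 0 := by
    intro i
    by_cases hi : i = 0
    · rw [hi]
    · exact (hxy i 0 hi).2.2.1
  obtain ⟨u, w, h01⟩ := (hxy 0 1 (by omega)).2.2.2
  have hk : ∃ k, ∀ i, ∃ z : ℤ, g i = k * gen T.Adj (a i) ^ z := by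
    refine ⟨g 0 * gen T.Adj (a 0) ^ u, ?_⟩
    intro i
    by_cases hi0 : i = 0
    · subst hi0
      exact ⟨-u, by group⟩
    by_cases hi1 : i = 1
    · subst hi1
      exact ⟨w, by rw [h01]; group⟩
    obtain ⟨u1, w1, e1⟩ := (hxy 0 i (Ne.symm hi0)).2.2.2
    obtain ⟨u2, w2, e2⟩ := (hxy 1 i (Ne.symm hi1)).2.2.2
    have e3 : gen T.Adj (a 1) ^ (-(w + u2)) * gen T.Adj (a 0) ^ (u1 - u) *
        gen T.Adj (a i) ^ (w1 - w2) = 1 := by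
      have e4 : gen T.Adj (a 1) ^ (-(w + u2)) * gen T.Adj (a 0) ^ (u1 - u) *
        gen T.Adj (a i) ^ (w1 - w2) = (g 0 * gen T.Adj (a 0) ^ u * gen T.Adj (a 1) ^ w *
          gen T.Adj (a 1) ^ u2)⁻¹ * (g 0 * (gen T.Adj (a 0) ^ u1 * gen T.Adj (a i) ^ w1)) *
          (gen T.Adj (a i) ^ w2)⁻¹ := by group
      rw [e4, ← e1, e2, h01]; group
    have e5 := three_one (hainj.ne (by omega : (1 : ℕ) ≠ 0)) (hainj.ne (Ne.symm hi0)) e3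
    refine ⟨w1, ?_⟩
    rw [e1]
    have e6 : gen T.Adj (a 0) ^ u1 = gen T.Adj (a 0) ^ u := by
      rwa [zpow_sub, mul_inv_eq_one] at e5
    rw [e6]; group
  obtain ⟨k, hk⟩ := hk
  have hform : ∀ i, h (gen T.Adj i) = k * lval T (a i, s 0) * k⁻¹ := by
    intro i
    obtain ⟨z, hz⟩ := hk i
    obtain ⟨y, hy⟩ := lval_zpow (T := T) (a i) (s 0)
    rw [hx i, hp1 i, hs0 i, hz, val_salt_self, pow_one, hy]
    group
  have hpw : ∀ i j e, (gen T.Adj i * gen T.Adj j) ^ e = 1 →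
      (lval T (a i, s 0) * lval T (a j, s 0)) ^ e = 1 := by
    intro i j e he
    have h1 : (h (gen T.Adj i) * h (gen T.Adj j)) ^ e = 1 := by
      rw [← map_mul, ← map_pow, he, map_one]
    have h2 : h (gen T.Adj i) * h (gen T.Adj j) =
        k * (lval T (a i, s 0) * lval T (a j, s 0)) * k⁻¹ := by
      rw [hform, hform]; group
    rwa [h2, conj_pow, conj_eq_one_iff] at h1
  refine ⟨k, s 0, a, hainj, hform, ?_⟩
  intro i j
  constructor
  · intro hA
    by_contra hB
    have hij := hainj.ne (T.ne_of_adj hA)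
    exact pair_ne hij _ _ (coprime_one (hpw i j 11 (gen_eleven hA)) (lval_thirteen hij hB _)
      (by norm_num))
  · intro hB
    by_contra hA
    have hij := T.ne_of_adj hB
    have hij' : i ≠ j := by rintro rfl; exact hij rfl
    exact pair_ne hij _ _ (coprime_one (hpw i j 13 (gen_thirteen hij' hA)) (lval_eleven hB _)
      (by norm_num))

theorem conj_lval {c d : ℕ} {s t : Bool} {g : GT T.Adj}
    (h : lval T (c, s) = g * lval T (d, t) * g⁻¹) : c = d := by
  by_contra hcd
  have e1 : ∀ x s, val T (salt s x x 1) = lval T (x, s) := fun x s => by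
    rw [val_salt_self, pow_one]
  have h1 : (val T (salt s c c 1) * (g * val T (salt (!t) d d 1) * g⁻¹)) ^ 1 = 1 := by
    rw [e1, e1, lval_inv, h]; group
  obtain ⟨⟨i, j, hg⟩, -⟩ := F2 (by norm_num) (by norm_num) (by norm_num) (by norm_num) g
    (by norm_num) h1
  obtain ⟨y, hy⟩ := lval_zpow (T := T) c s
  obtain ⟨z, hz⟩ := lval_zpow (T := T) d t
  apply pair_ne (T := T) hcd s (!t)
  rw [lval_inv]
  rw [hy, hz, hg] at h
  rw [hy, hz, mul_inv_eq_one]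
  have h2 : gen T.Adj c ^ y = (gen T.Adj c ^ i)⁻¹ * gen T.Adj c ^ y * gen T.Adj c ^ i := by group
  rw [h2, h]; group

theorem auto_form' (h : GT T.Adj ≃* GT T.Adj) :
    ∃ (k : GT T.Adj) (s : Bool) (ρ : ℕ ≃ ℕ),
      (∀ i, h (gen T.Adj i) = k * lval T (ρ i, s) * k⁻¹) ∧
      ∀ i j, T.Adj i j ↔ T.Adj (ρ i) (ρ j) := by
  obtain ⟨k, s, a, hinj, hf, hadj⟩ := auto_form (h : GT T.Adj →* GT T.Adj) h.injective
  obtain ⟨k', s', b, -, hf', -⟩ := auto_form (h.symm : GT T.Adj →* GT T.Adj) h.symm.injective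
  have hsurj : Function.Surjective a := by
    intro c
    refine ⟨b c, ?_⟩
    have h1 : gen T.Adj c = h k' * h (lval T (b c, s')) * (h k')⁻¹ := by
      have := congrArg h (hf' c)
      simpa using this
    have h2 : ∃ t, h (lval T (b c, s')) = k * lval T (a (b c), t) * k⁻¹ := by
      have h3 : h (gen T.Adj (b c)) = k * lval T (a (b c), s) * k⁻¹ := hf (b c)
      cases s'
      · refine ⟨!s, ?_⟩
        simp only [lval_inv]
        have : lval T (b c, false) = (gen T.Adj (b c))⁻¹ := by simp [lval]
        rw [this, map_inv, h3]; group
      · refine ⟨s, ?_⟩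
        have : lval T (b c, true) = gen T.Adj (b c) := by simp [lval]
        rw [this, h3]
    obtain ⟨t, ht⟩ := h2
    have h4 : lval T (c, true) = (h k' * k) * lval T (a (b c), t) * (h k' * k)⁻¹ := by
      have : lval T (c, true) = gen T.Adj c := by simp [lval]
      rw [this, h1, ht]; group
    exact (conj_lval h4).symm
  exact ⟨k, s, Equiv.ofBijective a ⟨hinj, hsurj⟩, hf, hadj⟩

end WG

namespace WG

variable {T : SimpleGraph ℕ}

/-- The endomorphism induced by a graph automorphism and a sign. -/
noncomputable def endo (T : SimpleGraph ℕ) (b : Bool) (ρ : ℕ ≃ ℕ)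
    (hρ : ∀ m n, T.Adj m n ↔ T.Adj (ρ m) (ρ n)) : GT T.Adj →* GT T.Adj :=
  PresentedGroup.toGroup (f := fun i => lval T (ρ i, b)) (rel_hom T _
    (fun i => lval_seven _ _)
    (fun i j h => lval_eleven ((hρ i j).mp h) b)
    (fun i j hij h => lval_thirteen (ρ.injective.ne hij) (fun e => h ((hρ i j).mpr e)) b))

theorem endo_gen (b : Bool) (ρ : ℕ ≃ ℕ) (hρ : ∀ m n, T.Adj m n ↔ T.Adj (ρ m) (ρ n)) (i : ℕ) :
    endo T b ρ hρ (gen T.Adj i) = lval T (ρ i, b) :=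
  PresentedGroup.toGroup.of _

theorem endo_endo (b : Bool) (ρ σ : ℕ ≃ ℕ) (hρ : ∀ m n, T.Adj m n ↔ T.Adj (ρ m) (ρ n))
    (hσ : ∀ m n, T.Adj m n ↔ T.Adj (σ m) (σ n)) (h : ∀ i, σ (ρ i) = i) (x : GT T.Adj) :
    endo T b σ hσ (endo T b ρ hρ x) = x := by
  have : (endo T b σ hσ).comp (endo T b ρ hρ) = MonoidHom.id _ := by
    apply PresentedGroup.ext
    intro i
    show endo T b σ hσ (endo T b ρ hρ (gen T.Adj i)) = gen T.Adj i
    rw [endo_gen]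
    cases b
    · simp only [lval, Bool.false_eq_true, if_false, map_inv, endo_gen, inv_inv, h]
    · simp only [lval, if_true, endo_gen, h]
  exact DFunLike.congr_fun this x

/-- The automorphism induced by a graph automorphism, a sign and a conjugating element. -/
theorem exists_auto (K : GT T.Adj) (b : Bool) (ρ : ℕ ≃ ℕ)
    (hρ : ∀ m n, T.Adj m n ↔ T.Adj (ρ m) (ρ n)) :
    ∃ E : GT T.Adj ≃* GT T.Adj, ∀ i, E (gen T.Adj i) = K * lval T (ρ i, b) * K⁻¹ := by
  have hρ' : ∀ m n, T.Adj m n ↔ T.Adj (ρ.symm m) (ρ.symm n) := by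
    intro m n
    have := hρ (ρ.symm m) (ρ.symm n)
    simp only [Equiv.apply_symm_apply] at this
    exact this.symm
  let E0 : GT T.Adj ≃* GT T.Adj := MulEquiv.mk'
    ⟨endo T b ρ hρ, endo T b ρ.symm hρ', endo_endo _ _ _ _ _ (by simp), endo_endo _ _ _ _ _ (by simp)⟩
    (fun x y => map_mul (endo T b ρ hρ) x y)
  refine ⟨E0.trans (MulAut.conj K), fun i => ?_⟩
  show K * endo T b ρ hρ (gen T.Adj i) * K⁻¹ = _
  rw [endo_gen]

theorem code_lval (c : CodingBijection T.Adj) (i : ℕ) (b : Bool) :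
    c.toEquiv (lval T (i, b)) = 3 * i + 1 + (if b then 0 else 1) := by
  cases b
  · simp [lval, c.map_gen_inv]
  · simp [lval, c.map_gen]

theorem mk_single (l : ℕ × Bool) :
    (QuotientGroup.mk (FreeGroup.mk [l]) : GT T.Adj) = lval T l := by
  obtain ⟨i, b⟩ := l
  cases b
  · have : FreeGroup.mk [(i, false)] = (FreeGroup.of i)⁻¹ := rfl
    rw [this]; rfl
  · rfl

/-- Backward direction: agreement with the automorphism. -/
theorem agree (c : CodingBijection T.Adj) (s : List ℕ) (E : GT T.Adj ≃* GT T.Adj)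
    (h1 : ∀ (n m : ℕ) (hn : n < s.length) (hm : m < s.length) (hnm : c.star n m < s.length),
          s.get ⟨c.star n m, hnm⟩ = c.star (s.get ⟨n, hn⟩) (s.get ⟨m, hm⟩))
    (h2 : ∀ (i : ℕ) (hi : 3 * i + 1 < s.length),
      s.get ⟨3 * i + 1, hi⟩ = c.toEquiv (E (gen T.Adj i))) (n : ℕ) :
    ∀ hn : n < s.length, s.get ⟨n, hn⟩ = c.toEquiv (E (c.toEquiv.symm n)) := by
  have h1' : ∀ (n m k : ℕ) (hn : n < s.length) (hm : m < s.length) (hk : k < s.length),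
      k = c.star n m → c.toEquiv.symm (s.get ⟨k, hk⟩) =
        c.toEquiv.symm (s.get ⟨n, hn⟩) * c.toEquiv.symm (s.get ⟨m, hm⟩) := by
    rintro n m k hn hm hk rfl
    rw [h1 n m hn hm hk, CodingBijection.star, Equiv.symm_apply_apply]
  have hzero : c.toEquiv.symm 0 = 1 := by rw [Equiv.symm_apply_eq, c.map_one]
  have h0 : ∀ hn : 0 < s.length, c.toEquiv.symm (s.get ⟨0, hn⟩) = 1 := by
    intro hn
    have := h1' 0 0 0 hn hn hn (by rw [CodingBijection.star, hzero, mul_one, c.map_one])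
    simpa using this
  induction n using Nat.strong_induction_on with
  | _ n ih =>
  intro hn
  rw [← Equiv.symm_apply_eq]
  have hword := c.word_mk (c.toEquiv.symm n)
  have hsub := c.subword_lt n
  have hred : FreeGroup.IsReduced (c.word (c.toEquiv.symm n)).toWord := FreeGroup.isReduced_toWord
  have hmk : FreeGroup.mk (c.word (c.toEquiv.symm n)).toWord = c.word (c.toEquiv.symm n) :=
    FreeGroup.mk_toWord
  rw [← hmk] at hword
  generalize (c.word (c.toEquiv.symm n)).toWord = w at hword hsub hred
  rcases w with _ | ⟨l, _ | ⟨l', w⟩⟩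
  · have hg : c.toEquiv.symm n = 1 := by rw [← hword]; rfl
    have hn0 : n = 0 := by rw [Equiv.symm_apply_eq, c.map_one] at hg; exact hg
    subst hn0
    rw [h0, hzero, map_one]
  · rw [mk_single] at hword
    obtain ⟨i, b⟩ := l
    have hnv : n = c.toEquiv (lval T (i, b)) := by rw [hword]; simp
    rw [code_lval] at hnv
    cases b
    · simp at hnv
      have hi : 3 * i + 1 < s.length := by omega
      have e1 := h1' (3 * i + 1) n 0 hi hn (by omega) (by
        rw [CodingBijection.star, ← c.map_gen, Equiv.symm_apply_apply, ← hword]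
        simp [lval, c.map_one])
      rw [h0, h2, Equiv.symm_apply_apply] at e1
      rw [← hword]
      have : lval T (i, false) = (gen T.Adj i)⁻¹ := by simp [lval]
      rw [this, map_inv]
      exact (inv_eq_of_mul_eq_one_right e1.symm).symm
    · simp at hnv
      subst hnv
      rw [h2, ← c.map_gen]
      simp
  · have hcons : (QuotientGroup.mk (FreeGroup.mk (l :: l' :: w)) : GT T.Adj) =
        QuotientGroup.mk (FreeGroup.mk [l]) * QuotientGroup.mk (FreeGroup.mk (l' :: w)) := by
      rw [← QuotientGroup.mk_mul, FreeGroup.mul_mk]; rfl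
    have hi1 : [l] <:+: l :: l' :: w := ⟨[], l' :: w, rfl⟩
    have hi2 : l' :: w <:+: l :: l' :: w := ⟨[l], [], by simp⟩
    have t1 : (FreeGroup.mk [l]).toWord = [l] := by
      rw [FreeGroup.toWord_mk, FreeGroup.IsReduced.singleton.reduce_eq]
    have t2 : (FreeGroup.mk (l' :: w)).toWord = l' :: w := by
      rw [FreeGroup.toWord_mk, (FreeGroup.isReduced_cons_cons.mp hred).2.reduce_eq]
    have l1 := hsub (FreeGroup.mk [l]) (by rw [t1]; exact hi1) (by rw [t1]; simp)
    have l2 := hsub (FreeGroup.mk (l' :: w)) (by rw [t2]; exact hi2) (by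
      rw [t2]; intro h; have := congrArg List.length h; simp at this)
    rw [hcons] at hword
    obtain ⟨x, hx⟩ : ∃ x : GT T.Adj, x = QuotientGroup.mk (FreeGroup.mk [l]) := ⟨_, rfl⟩
    obtain ⟨y, hy⟩ : ∃ y : GT T.Adj, y = QuotientGroup.mk (FreeGroup.mk (l' :: w)) := ⟨_, rfl⟩
    have l1' : c.toEquiv x < n := by rw [hx]; exact l1
    have l2' : c.toEquiv y < n := by rw [hy]; exact l2
    have hword' : x * y = c.toEquiv.symm n := by rw [hx, hy]; exact hword
    have e1 := h1' (c.toEquiv x) (c.toEquiv y) n (l1'.trans hn) (l2'.trans hn) hn (by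
      rw [CodingBijection.star, Equiv.symm_apply_apply, Equiv.symm_apply_apply, hword']; simp)
    rw [ih _ l1', ih _ l2'] at e1
    rw [e1, ← hword']
    simp

end WG

/-- **Proposition 3.8.** Let `T` be a simple graph on `ℕ`, `φ` a coding bijection for `G_T`
with induced operation `⋆`, and `s` an injective finite sequence of naturals. Then some
group automorphism of `(ℕ, ⋆)` extends `s` iff (1) `s` is partially multiplicative, and
(2) there is `r` defined on `{i : 3i+1 ∈ dom s}` such that (a) some graph automorphism of
`T` extends `r`, and (b) there are `k, k'` with `k ⋆ k' = 0` and `l ∈ {0, 1}` with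
`s(3i+1) = k ⋆ (3 r(i) + 1 + l) ⋆ k'` for all relevant `i`. -/
theorem automorphism_extension_criterion (T : SimpleGraph ℕ) (c : CodingBijection T.Adj)
    (s : List ℕ) (hs : s.Nodup) :
    (∃ h : ℕ → ℕ, Function.Bijective h ∧ (∀ n m, h (c.star n m) = c.star (h n) (h m)) ∧
        ∀ (n : ℕ) (hn : n < s.length), h n = s.get ⟨n, hn⟩) ↔
      ((∀ (n m : ℕ) (hn : n < s.length) (hm : m < s.length) (hnm : c.star n m < s.length),
          s.get ⟨c.star n m, hnm⟩ = c.star (s.get ⟨n, hn⟩) (s.get ⟨m, hm⟩)) ∧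
        ∃ r : ℕ → ℕ,
          (∃ ρ : ℕ ≃ ℕ, (∀ m n, T.Adj m n ↔ T.Adj (ρ m) (ρ n)) ∧
            ∀ i, 3 * i + 1 < s.length → ρ i = r i) ∧
          ∃ k k' l : ℕ, c.star k k' = 0 ∧ (l = 0 ∨ l = 1) ∧
            ∀ (i : ℕ) (hi : 3 * i + 1 < s.length),
              s.get ⟨3 * i + 1, hi⟩ = c.star (c.star k (3 * r i + 1 + l)) k') := by
  have hstar : ∀ x y, c.star (c.toEquiv x) (c.toEquiv y) = c.toEquiv (x * y) := by
    intro x y; simp [CodingBijection.star]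
  constructor
  · rintro ⟨h, hbij, hmul, hext⟩
    refine ⟨?_, ?_⟩
    · intro n m hn hm hnm
      rw [← hext, ← hext, ← hext, hmul]
    · let H : GT T.Adj ≃* GT T.Adj := MulEquiv.mk'
        ((c.toEquiv.trans (Equiv.ofBijective h hbij)).trans c.toEquiv.symm) (by
          intro x y
          show c.toEquiv.symm (h (c.toEquiv (x * y))) =
            c.toEquiv.symm (h (c.toEquiv x)) * c.toEquiv.symm (h (c.toEquiv y))
          rw [← hstar, hmul, Equiv.symm_apply_eq, CodingBijection.star])
      have hH : ∀ x, c.toEquiv (H x) = h (c.toEquiv x) := by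
        intro x
        show c.toEquiv (c.toEquiv.symm (h (c.toEquiv x))) = _
        simp
      obtain ⟨k, b, ρ, hf, hadj⟩ := WG.auto_form' H
      refine ⟨ρ, ⟨ρ, hadj, fun _ _ => rfl⟩, c.toEquiv k, c.toEquiv k⁻¹, if b then 0 else 1, ?_, ?_,
        ?_⟩
      · rw [hstar, mul_inv_cancel, c.map_one]
      · cases b <;> simp
      · intro i hi
        rw [← hext, ← c.map_gen, ← hH, hf, ← WG.code_lval c, hstar, hstar]
  · rintro ⟨h1, r, ⟨ρ, hadj, hr⟩, k, k', l, hk, hl, h2⟩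
    obtain ⟨b, hb⟩ : ∃ b : Bool, l = if b then 0 else 1 := by
      rcases hl with rfl | rfl
      · exact ⟨true, rfl⟩
      · exact ⟨false, rfl⟩
    obtain ⟨K, rfl⟩ := c.toEquiv.surjective k
    obtain ⟨K', rfl⟩ := c.toEquiv.surjective k'
    have hK : K' = K⁻¹ := by
      rw [hstar, ← c.map_one] at hk
      exact (inv_eq_of_mul_eq_one_right (c.toEquiv.injective hk)).symm
    subst hK
    obtain ⟨E, hE⟩ := WG.exists_auto K b ρ hadj
    refine ⟨fun n => c.toEquiv (E (c.toEquiv.symm n)), ?_, ?_, ?_⟩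
    · exact c.toEquiv.bijective.comp (E.bijective.comp c.toEquiv.symm.bijective)
    · intro n m
      simp [CodingBijection.star]
    · intro n hn
      refine (WG.agree c s E h1 ?_ n hn).symm
      intro i hi
      rw [h2, hE, ← hr i hi, hb, ← WG.code_lval c, hstar, hstar]
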